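/- Let G be a countable group admitting a finite chain-commuting generating set S whose elements all have infinite order, and containing an element s₀ whose centralizer in G is nonamenable. Let G ↷ X be a nontrivial Bernoulli action of G, and let H be any countable group. Then every cocycle c : G × X → H is cohomologous to a cocycle of the form (g,x) ↦ δ(g) for some group homomorphism δ : G → H. -/

import Mathlib

open MeasureTheory
open scoped ENNReal Pointwise symmDiff

namespace OEPaper

/- ## Right-angled Artin groups and graph combinatorics -/

/-- The commutation relations defining the right-angled Artin group of a graph. -/
def raagRels {V : Type} (Γ : SimpleGraph V) : Set (FreeGroup V) :=
  {r | ∃ u v : V, Γ.Adj u v ∧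
    r = FreeGroup.of u * FreeGroup.of v * (FreeGroup.of u)⁻¹ * (FreeGroup.of v)⁻¹}

/-- The right-angled Artin group of a simple graph `Γ`. -/
abbrev RAAG {V : Type} (Γ : SimpleGraph V) : Type := PresentedGroup (raagRels Γ)

/-- The standard generator of `RAAG Γ` associated to a vertex. -/
def gen {V : Type} (Γ : SimpleGraph V) (v : V) : RAAG Γ := PresentedGroup.of v

/-- The standard subgroup associated to (the full subgraph spanned by) a set of vertices. -/
def standardSub {V : Type} (Γ : SimpleGraph V) (S : Set V) : Subgroup (RAAG Γ) :=
  Subgroup.closure (gen Γ '' S)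

/-- Conjugate of a subgroup. -/
def conjSub {G : Type} [Group G] (g : G) (P : Subgroup G) : Subgroup G :=
  Subgroup.map (MulAut.conj g).toMonoidHom P

/-- Parabolic subgroups: conjugates of standard subgroups. -/
def IsParabolic {V : Type} (Γ : SimpleGraph V) (P : Subgroup (RAAG Γ)) : Prop :=
  ∃ (g : RAAG Γ) (S : Set V), P = conjSub g (standardSub Γ S)

/-- The "orthogonal" of a set of vertices: vertices outside `S` adjacent to every vertex of `S`. -/
def perp {V : Type} (Γ : SimpleGraph V) (S : Set V) : Set V :=
  {v : V | v ∉ S ∧ ∀ u ∈ S, Γ.Adj v u}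

/-- `S` spans a join subgraph of `Γ`. -/
def IsJoin {V : Type} (Γ : SimpleGraph V) (S : Set V) : Prop :=
  ∃ S₁ S₂ : Set V, S₁.Nonempty ∧ S₂.Nonempty ∧ S₁ ∪ S₂ = S ∧ ∀ u ∈ S₁, ∀ v ∈ S₂, Γ.Adj u v

/-- `S` spans a maximal join subgraph of `Γ`. -/
def IsMaxJoin {V : Type} (Γ : SimpleGraph V) (S : Set V) : Prop :=
  IsJoin Γ S ∧ ∀ T : Set V, IsJoin Γ T → S ⊆ T → S = T

/-- Join parabolic subgroups. -/
def IsJoinParabolic {V : Type} (Γ : SimpleGraph V) (P : Subgroup (RAAG Γ)) : Prop :=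
  ∃ (g : RAAG Γ) (S : Set V), IsJoin Γ S ∧ P = conjSub g (standardSub Γ S)

/-- Maximal join parabolic subgroups. -/
def IsMaxJoinParabolic {V : Type} (Γ : SimpleGraph V) (P : Subgroup (RAAG Γ)) : Prop :=
  ∃ (g : RAAG Γ) (S : Set V), IsMaxJoin Γ S ∧ P = conjSub g (standardSub Γ S)

/-- The center of a subgroup `P`, as a subset of the ambient group. -/
def subCenter {G : Type} [Group G] (P : Subgroup G) : Set G :=
  {x : G | x ∈ P ∧ ∀ y ∈ P, x * y = y * x}

/-- The commutation graph of a subset `S` of a group. -/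
def chainCommGraph {G : Type} [Group G] (S : Set G) : SimpleGraph S :=
  SimpleGraph.fromRel fun a b => Commute (a : G) (b : G)

/-- A generating set is chain-commuting if its commutation graph is connected. -/
def IsChainCommuting {G : Type} [Group G] (S : Set G) : Prop :=
  (chainCommGraph S).Connected

/-- Amenability: existence of a finitely additive left-invariant probability
measure defined on all subsets. -/
def IsAmenable (G : Type) [Group G] : Prop :=
  ∃ m : Set G → ℝ, m Set.univ = 1 ∧ (∀ A : Set G, 0 ≤ m A) ∧
    (∀ A B : Set G, Disjoint A B → m (A ∪ B) = m A + m B) ∧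
    ∀ (g : G) (A : Set G), m ((g * ·) '' A) = m A

/-- ICC groups: every nontrivial element has an infinite conjugacy class. -/
def IsICC (G : Type) [Group G] : Prop :=
  ∀ g : G, g ≠ 1 → {h : G | ∃ c : G, c * g * c⁻¹ = h}.Infinite

/-- The root-conjugation property. -/
def RootConjugationProperty (H : Type) [Group H] : Prop :=
  ∀ (h₁ h₂ : H) (k : ℕ), 0 < k → Commute h₁ (h₂ ^ k) → Commute h₁ h₂

/- ## Measured dynamics -/

/-- Measure-preserving action by measurable automorphisms. -/
def PmpAction (G : Type) [Group G] (X : Type) [MeasurableSpace X] [MulAction G X]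
    (μ : Measure X) : Prop :=
  ∀ g : G, MeasurePreserving (fun x : X => g • x) μ μ

/-- Essentially free action. -/
def FreeAction (G : Type) [Group G] (X : Type) [MeasurableSpace X] [MulAction G X]
    (μ : Measure X) : Prop :=
  ∀ g : G, g ≠ 1 → μ {x : X | g • x = x} = 0

/-- Ergodic action of a group. -/
def ErgodicAction (G : Type) [Group G] (X : Type) [MeasurableSpace X] [MulAction G X]
    (μ : Measure X) : Prop :=
  ∀ A : Set X, MeasurableSet A → (∀ g : G, (fun x : X => g • x) ⁻¹' A = A) →
    μ A = 0 ∨ μ A = 1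

/-- Ergodicity of the action of a subgroup. -/
def ErgodicSubgroup (G : Type) [Group G] (A : Subgroup G) (X : Type) [MeasurableSpace X]
    [MulAction G X] (μ : Measure X) : Prop :=
  ∀ s : Set X, MeasurableSet s → (∀ a ∈ A, (fun x : X => a • x) ⁻¹' s = s) →
    μ s = 0 ∨ μ s = 1

/-- Irreducible action of a right-angled Artin group: for some identification of the group
with a `RAAG Δ`, every standard generator acts ergodically. -/
def IrreducibleAction (G : Type) [Group G] (X : Type) [MeasurableSpace X] [MulAction G X]
    (μ : Measure X) : Prop :=
  ∃ (n : ℕ) (Δ : SimpleGraph (Fin n)) (e : RAAG Δ ≃* G),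
    ∀ v : Fin n, Ergodic (fun x : X => e (gen Δ v) • x) μ

/-- A measure space isomorphism (mod null sets): a measurable measure-preserving map
admitting an a.e. two-sided measurable inverse. -/
def MeasIso {A : Type} {B : Type} [MeasurableSpace A] [MeasurableSpace B]
    (μ : Measure A) (ν : Measure B) (F : A → B) : Prop :=
  Measurable F ∧ MeasurePreserving F μ ν ∧
    ∃ F' : B → A, Measurable F' ∧ (∀ᵐ a ∂μ, F' (F a) = a) ∧ ∀ᵐ b ∂ν, F (F' b) = b

/-- Conjugacy of two actions through a given group isomorphism. -/
def ConjugateVia (G : Type) [Group G] (X : Type) [MeasurableSpace X] [MulAction G X]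
    (H : Type) [Group H] (Y : Type) [MeasurableSpace Y] [MulAction H Y]
    (μ : Measure X) (ν : Measure Y) (α : G ≃* H) : Prop :=
  ∃ F : X → Y, MeasIso μ ν F ∧ ∀ g : G, ∀ᵐ x ∂μ, F (g • x) = α g • F x

/-- Conjugacy of two actions. -/
def ConjugateActions (G : Type) [Group G] (X : Type) [MeasurableSpace X] [MulAction G X]
    (H : Type) [Group H] (Y : Type) [MeasurableSpace Y] [MulAction H Y]
    (μ : Measure X) (ν : Measure Y) : Prop :=
  ∃ α : G ≃* H, ConjugateVia G X H Y μ ν α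

/-- Orbit equivalence of two actions. -/
def OrbitEquivalent (G : Type) [Group G] (X : Type) [MeasurableSpace X] [MulAction G X]
    (H : Type) [Group H] (Y : Type) [MeasurableSpace Y] [MulAction H Y]
    (μ : Measure X) (ν : Measure Y) : Prop :=
  ∃ F : X → Y, MeasIso μ ν F ∧
    ∀ᵐ x ∂μ, F '' MulAction.orbit G x = MulAction.orbit H (F x)

/-- Measurable cocycle for an action, with values in a (discrete) group `H`. -/
def IsCocycle (G : Type) [Group G] (X : Type) [MeasurableSpace X] [MulAction G X]
    (H : Type) [Group H] (μ : Measure X) (c : G → X → H) : Prop :=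
  (∀ (g : G) (h : H), MeasurableSet {x : X | c g x = h}) ∧
    ∀ g g' : G, ∀ᵐ x ∂μ, c (g * g') x = c g (g' • x) * c g' x

/-- Cohomology of cocycles. -/
def Cohomologous (G : Type) [Group G] (X : Type) [MeasurableSpace X] [MulAction G X]
    (H : Type) [Group H] (μ : Measure X) (c c' : G → X → H) : Prop :=
  ∃ φ : X → H, (∀ h : H, MeasurableSet {x : X | φ x = h}) ∧
    ∀ g : G, ∀ᵐ x ∂μ, c' g x = φ (g • x) * c g x * (φ x)⁻¹

/-- A stable orbit equivalence between two actions: a measure-scaling Borel isomorphism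
between positive measure subsets, matching orbits. -/
structure StableOE (G : Type) [Group G] (X : Type) [MeasurableSpace X] [MulAction G X]
    (H : Type) [Group H] (Y : Type) [MeasurableSpace Y] [MulAction H Y]
    (μ : Measure X) (ν : Measure Y) where
  U : Set X
  V : Set Y
  measU : MeasurableSet U
  measV : MeasurableSet V
  posU : 0 < μ U
  posV : 0 < ν V
  toFun : X → Y
  invFun : Y → X
  meas_toFun : Measurable toFun
  meas_invFun : Measurable invFun
  maps : Set.MapsTo toFun U V
  maps_inv : Set.MapsTo invFun V U
  left_inv : ∀ x ∈ U, invFun (toFun x) = x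
  right_inv : ∀ y ∈ V, toFun (invFun y) = y
  pushforward : ∀ B : Set Y, B ⊆ V → MeasurableSet B →
    (μ U)⁻¹ * μ (U ∩ toFun ⁻¹' B) = (ν V)⁻¹ * ν B
  orbit_eq : ∀ᵐ x ∂μ, x ∈ U →
    toFun '' (MulAction.orbit G x ∩ U) = MulAction.orbit H (toFun x) ∩ V

namespace StableOE

variable {G : Type} [Group G] {X : Type} [MeasurableSpace X] [MulAction G X]
  {H : Type} [Group H] {Y : Type} [MeasurableSpace Y] [MulAction H Y]
  {μ : Measure X} {ν : Measure Y}

/-- The compression constant of a stable orbit equivalence. -/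
noncomputable def kappa (f : StableOE G X H Y μ ν) : ℝ≥0∞ := ν f.V / μ f.U

/-- `c` is an SOE cocycle associated to the stable orbit equivalence `f`. -/
def IsSOECocycle (f : StableOE G X H Y μ ν) (c : G → X → H) : Prop :=
  IsCocycle G X H μ c ∧
    ∃ p : X → X, Measurable p ∧
      (∀ᵐ x ∂μ, p x ∈ f.U ∧ p x ∈ MulAction.orbit G x) ∧
      ∀ g : G, ∀ᵐ x ∂μ, f.toFun (p (g • x)) = c g x • f.toFun (p x)

end StableOE

/-- Mildly mixing action. -/
def MildlyMixing (H : Type) [Group H] (Y : Type) [MeasurableSpace Y] [MulAction H Y]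
    (ν : Measure Y) : Prop :=
  ∀ A : Set Y, MeasurableSet A → ν A ≠ 0 → ν A ≠ ν Set.univ →
    ∀ u : ℕ → H, Function.Injective u →
      0 < Filter.atTop.liminf fun n => ν (((u n • ·) '' A) ∆ A)

/- ## Virtual conjugacy -/

/-- `(Z, qact, ρ)` together with `π : X → Z` is a model for the quotient of the action
`G ↷ (X, μ)` by the normal subgroup `F`, with the induced `G ⧸ F`-action. -/
def IsQuotientModel {G : Type} [Group G] (F : Subgroup G) [F.Normal]
    {X : Type} [MeasurableSpace X] [MulAction G X] (μ : Measure X)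
    {Z : Type} [MeasurableSpace Z] (qact : G ⧸ F →* Equiv.Perm Z) (ρ : Measure Z)
    (π : X → Z) : Prop :=
  Measurable π ∧ Measure.map π μ = ρ ∧
    (∀ (g : G) (x : X), π (g • x) = qact (QuotientGroup.mk g) (π x)) ∧
    ∀ x y : X, π x = π y ↔ ∃ f ∈ F, f • x = y

/-- The action `act : Q →* Perm Z` on `(Z, ρ)` is (isomorphic to) the action induced from the
action `act' : K →* Perm X'` of the finite-index subgroup `K` on `(X', μ')`. -/
def InducedFrom {Q : Type} [Group Q] (K : Subgroup Q)
    {Z : Type} [MeasurableSpace Z] (act : Q →* Equiv.Perm Z) (ρ : Measure Z)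
    {X' : Type} [MeasurableSpace X'] (act' : ↥K →* Equiv.Perm X') (μ' : Measure X') : Prop :=
  letI : MeasurableSpace (Q ⧸ K) := ⊤
  ∃ σ : Q ⧸ K → Q, (∀ k : Q ⧸ K, (QuotientGroup.mk (σ k) : Q ⧸ K) = k) ∧
    ∃ Φ : X' × (Q ⧸ K) → Z,
      MeasIso (Measure.sum fun k : Q ⧸ K =>
        (K.index : ℝ≥0∞)⁻¹ • Measure.map (fun x' : X' => (x', k)) μ') ρ Φ ∧
      ∀ (g : Q) (k : Q ⧸ K) (h : ↥K), (h : Q) = (σ (g • k))⁻¹ * g * σ k →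
        ∀ᵐ x' ∂μ', Φ (act' h x', g • k) = act g (Φ (x', k))

/-- Data witnessing that two probability measure-preserving actions are virtually
conjugate. -/
structure VirtualConjugacyData
    (G₁ : Type) [Group G₁] (X₁ : Type) [MeasurableSpace X₁] [MulAction G₁ X₁] (μ₁ : Measure X₁)
    (G₂ : Type) [Group G₂] (X₂ : Type) [MeasurableSpace X₂] [MulAction G₂ X₂] (μ₂ : Measure X₂) :
    Type 1 where
  F₁ : Subgroup G₁
  F₂ : Subgroup G₂
  normal₁ : F₁.Normal
  normal₂ : F₂.Normal
  finite₁ : Finite F₁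
  finite₂ : Finite F₂
  K₁ : Subgroup (G₁ ⧸ F₁)
  K₂ : Subgroup (G₂ ⧸ F₂)
  finiteIndex₁ : K₁.FiniteIndex
  finiteIndex₂ : K₂.FiniteIndex
  X'₁ : Type
  X'₂ : Type
  mX'₁ : MeasurableSpace X'₁
  mX'₂ : MeasurableSpace X'₂
  μ'₁ : Measure X'₁
  μ'₂ : Measure X'₂
  prob₁ : IsProbabilityMeasure μ'₁
  prob₂ : IsProbabilityMeasure μ'₂
  act₁ : ↥K₁ →* Equiv.Perm X'₁
  act₂ : ↥K₂ →* Equiv.Perm X'₂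
  pmp₁ : ∀ k : ↥K₁, MeasurePreserving (act₁ k) μ'₁ μ'₁
  pmp₂ : ∀ k : ↥K₂, MeasurePreserving (act₂ k) μ'₂ μ'₂
  θ : ↥K₁ ≃* ↥K₂
  conjF : X'₁ → X'₂
  conjF_iso : MeasIso μ'₁ μ'₂ conjF
  conjF_equivariant : ∀ k : ↥K₁, ∀ᵐ x ∂μ'₁, conjF (act₁ k x) = act₂ (θ k) (conjF x)
  Z₁ : Type
  Z₂ : Type
  mZ₁ : MeasurableSpace Z₁
  mZ₂ : MeasurableSpace Z₂
  ρ₁ : Measure Z₁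
  ρ₂ : Measure Z₂
  qact₁ : G₁ ⧸ F₁ →* Equiv.Perm Z₁
  qact₂ : G₂ ⧸ F₂ →* Equiv.Perm Z₂
  qpmp₁ : ∀ g, MeasurePreserving (qact₁ g) ρ₁ ρ₁
  qpmp₂ : ∀ g, MeasurePreserving (qact₂ g) ρ₂ ρ₂
  π₁ : X₁ → Z₁
  π₂ : X₂ → Z₂
  quot₁ : IsQuotientModel F₁ μ₁ qact₁ ρ₁ π₁
  quot₂ : IsQuotientModel F₂ μ₂ qact₂ ρ₂ π₂
  ind₁ : InducedFrom K₁ qact₁ ρ₁ act₁ μ'₁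
  ind₂ : InducedFrom K₂ qact₂ ρ₂ act₂ μ'₂

/- ## Bernoulli actions -/

/-- The Bernoulli shift action of `G` on `G → A`. -/
instance bernoulliAction (G A : Type) [Group G] : MulAction G (G → A) where
  smul g x := fun h => x (g⁻¹ * h)
  one_smul x := funext fun h => by
    show x (1⁻¹ * h) = x h
    rw [inv_one, one_mul]
  mul_smul g g' x := funext fun h => by
    show x ((g * g')⁻¹ * h) = x (g'⁻¹ * (g⁻¹ * h))
    rw [mul_inv_rev, mul_assoc]

/-- `μ` is the product (Bernoulli) measure on `G → A` with base `μ₀`: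
it gives the product value to every cylinder set. -/
def IsBernoulliMeasure (G : Type) [Group G] {A : Type} [MeasurableSpace A]
    (μ₀ : Measure A) (μ : Measure (G → A)) : Prop :=
  ∀ (s : Finset G) (B : G → Set A), (∀ g : G, MeasurableSet (B g)) →
    μ {x : G → A | ∀ g ∈ s, x g ∈ B g} = ∏ g ∈ s, μ₀ (B g)


/-- `𝓕`-ergodicity: every subgroup in the collection `𝓕` acts ergodically. -/
def FErgodic (G : Type) [Group G] (𝓕 : Set (Subgroup G)) (X : Type) [MeasurableSpace X]
    [MulAction G X] (μ : Measure X) : Prop :=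
  ∀ A ∈ 𝓕, ErgodicSubgroup G A X μ

/-- Strong cocycle-rigidity of the pair `(G, 𝓕)`. -/
def StronglyCocycleRigid (G : Type) [Group G] (𝓕 : Set (Subgroup G)) : Prop :=
  ∀ (X : Type) [MeasurableSpace X] [StandardBorelSpace X] (μ : Measure X)
    (Y : Type) [MeasurableSpace Y] [StandardBorelSpace Y] (ν : Measure Y)
    [IsProbabilityMeasure μ] [IsProbabilityMeasure ν]
    [MulAction G X] [MulAction G Y],
    PmpAction G X μ → FreeAction G X μ → ErgodicAction G X μ → FErgodic G 𝓕 X μ →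
    PmpAction G Y ν → FreeAction G Y ν → ErgodicAction G Y ν → FErgodic G 𝓕 Y ν →
    ∀ f : StableOE G X G Y μ ν, ∀ c : G → X → G, f.IsSOECocycle c →
      ∃ α : G ≃* G, Cohomologous G X G μ c fun g _ => α g

/-! ### Bernoulli measures -/

section Bernoulli

open Filter Topology

variable {G : Type}

/-- The Bernoulli measure on `G → B` with base `β`. -/
noncomputable abbrev bern (G : Type) {B : Type} [MeasurableSpace B] (β : Measure B) :
    Measure (G → B) :=
  Measure.infinitePi fun _ => β

theorem tendsto_tsum_ennreal_of_dominated {ι : Type} [Countable ι] {f : ℕ → ι → ℝ≥0∞}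
    {g bound : ι → ℝ≥0∞} (hb : ∑' i, bound i ≠ ∞) (hf : ∀ n i, f n i ≤ bound i)
    (hlim : ∀ i, Tendsto (fun n => f n i) atTop (𝓝 (g i))) :
    Tendsto (fun n => ∑' i, f n i) atTop (𝓝 (∑' i, g i)) := by
  let _ : MeasurableSpace ι := ⊤
  simp only [← lintegral_count] at hb ⊢
  exact tendsto_lintegral_of_dominated_convergence bound (fun n => measurable_from_top)
    (fun n => Eventually.of_forall (hf n)) hb (Eventually.of_forall hlim)

section

variable {B : Type} [Group G]

theorem bernoulli_smul_apply {B : Type} (g h : G) (z : G → B) : (g • z) h = z (g⁻¹ * h) := rfl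

theorem preimage_smul_pi [DecidableEq G] (g : G) (s : Finset G) (t : G → Set B) :
    (fun z : G → B => g • z) ⁻¹' (s : Set G).pi t =
      ((s.image fun h => g⁻¹ * h : Finset G) : Set G).pi fun h => t (g * h) := by
  ext z
  simp only [Set.mem_preimage, Set.mem_pi, Finset.mem_coe, bernoulli_smul_apply,
    Finset.forall_mem_image, mul_inv_cancel_left]

end

variable {B : Type} [MeasurableSpace B]

theorem isPiSystem_pi_finset :
    IsPiSystem (squareCylinders fun _ : G => {t : Set B | MeasurableSet t}) :=
  isPiSystem_squareCylinders (fun _ => MeasurableSpace.isPiSystem_measurableSet)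
    fun _ => MeasurableSet.univ

variable {β : Measure B} [IsProbabilityMeasure β]

theorem bern_map {B' : Type} [MeasurableSpace B'] {p : B → B'} (hp : Measurable p) :
    (bern G β).map (fun z g => p (z g)) = bern G (β.map p) :=
  Measure.infinitePi_map_pi (fun _ : G => β) (fun _ => hp)

theorem measurePreserving_bern_map {B' : Type} [MeasurableSpace B'] {p : B → B'}
    {β' : Measure B'} (hp : MeasurePreserving p β β') :
    MeasurePreserving (fun (z : G → B) g => p (z g)) (bern G β) (bern G β') := by
  refine ⟨measurable_pi_lambda _ fun g => hp.measurable.comp (measurable_pi_apply g), ?_⟩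
  rw [bern_map hp.measurable, hp.map_eq]

/-- Cylinder sets over disjoint sets of coordinates are independent. -/
theorem bern_pi_inter_pi {s s' : Finset G} (hss' : Disjoint s s') {t t' : G → Set B}
    (ht : ∀ g, MeasurableSet (t g)) (ht' : ∀ g, MeasurableSet (t' g)) :
    bern G β ((s : Set G).pi t ∩ (s' : Set G).pi t') =
      bern G β ((s : Set G).pi t) * bern G β ((s' : Set G).pi t') := by
  classical
  have h : (s : Set G).pi t ∩ (s' : Set G).pi t' =
      ((s ∪ s' : Finset G) : Set G).pi (fun g => if g ∈ s then t g else t' g) := by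
    ext z
    simp only [Set.mem_inter_iff, Set.mem_pi, Finset.mem_coe, Finset.mem_union]
    constructor
    · rintro ⟨h1, h2⟩ g hg
      by_cases hgs : g ∈ s
      · simpa [hgs] using h1 g hgs
      · simpa [hgs] using h2 g (hg.resolve_left hgs)
    · intro h
      refine ⟨fun g hg => by simpa [hg] using h g (Or.inl hg), fun g hg => ?_⟩
      have hgs : g ∉ s := fun h' => Finset.disjoint_left.mp hss' h' hg
      simpa [hgs] using h g (Or.inr hg)
  rw [h, Measure.infinitePi_pi _ fun g _ => by split_ifs <;> simp [ht, ht'],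
    Measure.infinitePi_pi _ fun g _ => ht g, Measure.infinitePi_pi _ fun g _ => ht' g,
    Finset.prod_union hss']
  congr 1
  · exact Finset.prod_congr rfl fun g hg => by simp [hg]
  · refine Finset.prod_congr rfl fun g hg => ?_
    have hgs : g ∉ s := fun h' => Finset.disjoint_left.mp hss' h' hg
    simp [hgs]

variable [Group G]

@[fun_prop]
theorem measurable_bernoulli_smul (g : G) : Measurable fun z : G → B => g • z :=
  measurable_pi_lambda _ fun h => measurable_pi_apply (g⁻¹ * h)

theorem measurePreserving_smul_bern (g : G) :
    MeasurePreserving (fun z : G → B => g • z) (bern G β) (bern G β) := by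
  refine ⟨measurable_bernoulli_smul g, ?_⟩
  exact Measure.map_infinitePi_infinitePi_of_inj (P := fun _ : G => β)
    (f := fun h => g⁻¹ * h) (mul_right_injective g⁻¹)

theorem IsBernoulliMeasure.eq_bern {μ : Measure (G → B)} (h : IsBernoulliMeasure G β μ) :
    μ = bern G β := by
  refine Measure.eq_infinitePi _ fun s t ht => ?_
  rw [← h s t ht]
  rfl

theorem eventually_disjoint_image_pow [DecidableEq G] {s : G} (hs : ¬ IsOfFinOrder s)
    (F F' : Finset G) :
    ∀ᶠ n : ℕ in atTop, Disjoint F (F'.image fun h => (s ^ n)⁻¹ * h) := by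
  have key : ∀ g ∈ F, ∀ g' ∈ F', ∀ᶠ n : ℕ in atTop, g ≠ (s ^ n)⁻¹ * g' := by
    intro g _ g' _
    rw [← Nat.cofinite_eq_atTop]
    have hsub : {n : ℕ | g = (s ^ n)⁻¹ * g'}.Subsingleton := by
      intro n hn m hm
      have h : (s ^ n)⁻¹ * g' = (s ^ m)⁻¹ * g' := by rw [← hn, ← hm]
      exact injective_pow_iff_not_isOfFinOrder.mpr hs (inv_injective (mul_right_cancel h))
    simpa [Filter.eventually_cofinite] using hsub.finite
  have := (Filter.eventually_all_finset F).mpr fun g hg =>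
    (Filter.eventually_all_finset F').mpr fun g' hg' => key g hg g' hg'
  filter_upwards [this] with n hn
  rw [Finset.disjoint_left]
  intro g hg hg'
  obtain ⟨g', hg'F, rfl⟩ := Finset.mem_image.mp hg'
  exact hn _ hg g' hg'F rfl

/-- Powers of an element of infinite order asymptotically decorrelate cylinders from every
measurable set. -/
theorem tendsto_bern_inter_preimage {s : G} (hs : ¬ IsOfFinOrder s) (F : Finset G)
    {t : G → Set B} (ht : ∀ g, MeasurableSet (t g)) {E : Set (G → B)} (hE : MeasurableSet E) :
    Tendsto (fun n : ℕ => bern G β (E ∩ (fun z => s ^ n • z) ⁻¹' (F : Set G).pi t)) atTop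
      (𝓝 (bern G β E * bern G β ((F : Set G).pi t))) := by
  classical
  have hD : MeasurableSet ((F : Set G).pi t) := .pi F.countable_toSet fun g _ => ht g
  have hDn (n : ℕ) : MeasurableSet ((fun z : G → B => s ^ n • z) ⁻¹' (F : Set G).pi t) :=
    measurable_bernoulli_smul (s ^ n) hD
  have hmp (n : ℕ) : bern G β ((fun z : G → B => s ^ n • z) ⁻¹' (F : Set G).pi t) =
      bern G β ((F : Set G).pi t) :=
    (measurePreserving_smul_bern (s ^ n)).measure_preimage hD.nullMeasurableSet
  induction E, hE using MeasurableSpace.induction_on_inter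
    (generateFrom_squareCylinders (α := fun _ : G => B)).symm isPiSystem_pi_finset with
  | empty => simp
  | basic E hE =>
    obtain ⟨F', t', ht', rfl⟩ := hE
    have ht'' : ∀ g, MeasurableSet (t' g) := fun g => ht' g trivial
    refine tendsto_const_nhds.congr' ?_
    filter_upwards [eventually_disjoint_image_pow hs F' F] with n hn
    rw [preimage_smul_pi, bern_pi_inter_pi hn ht'' (fun _ => ht _), ← preimage_smul_pi, hmp]
  | compl E hE ih =>
    have h (n : ℕ) : bern G β (Eᶜ ∩ (fun z => s ^ n • z) ⁻¹' (F : Set G).pi t) =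
        bern G β ((F : Set G).pi t) -
          bern G β (E ∩ (fun z => s ^ n • z) ⁻¹' (F : Set G).pi t) := by
      rw [← hmp n, ← measure_sdiff Set.inter_subset_right
        (hE.inter (hDn n)).nullMeasurableSet (measure_ne_top _ _)]
      congr 1
      ext z
      simp only [Set.mem_inter_iff, Set.mem_compl_iff, Set.mem_sdiff]
      tauto
    simp_rw [h]
    rw [prob_compl_eq_one_sub hE, ENNReal.sub_mul fun _ _ => measure_ne_top _ _, one_mul]
    exact ENNReal.Tendsto.sub tendsto_const_nhds ih (Or.inl (measure_ne_top _ _))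
  | iUnion f hd hf ih =>
    have h (n : ℕ) : bern G β ((⋃ i, f i) ∩ (fun z => s ^ n • z) ⁻¹' (F : Set G).pi t) =
        ∑' i, bern G β (f i ∩ (fun z => s ^ n • z) ⁻¹' (F : Set G).pi t) := by
      rw [Set.iUnion_inter, measure_iUnion]
      · exact fun i j hij => (hd hij).mono Set.inter_subset_left Set.inter_subset_left
      · exact fun i => (hf i).inter (hDn n)
    simp_rw [h]
    rw [measure_iUnion hd hf, ← ENNReal.tsum_mul_right]
    refine tendsto_tsum_ennreal_of_dominated (bound := fun i => bern G β (f i)) ?_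
      (fun n i => measure_mono Set.inter_subset_left) ih
    rw [← measure_iUnion hd hf]
    exact measure_ne_top _ _

/-- Elements of infinite order act ergodically on Bernoulli spaces. -/
theorem ae_mem_of_smul_invariant {s : G} (hs : ¬ IsOfFinOrder s) {E : Set (G → B)}
    (hE : MeasurableSet E) (hinv : ∀ᵐ z ∂bern G β, s • z ∈ E ↔ z ∈ E)
    (hpos : bern G β E ≠ 0) : ∀ᵐ z ∂bern G β, z ∈ E := by
  have hinv' (n : ℕ) : ∀ᵐ z ∂bern G β, s ^ n • z ∈ E ↔ z ∈ E := by
    induction n with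
    | zero => simp
    | succ n ih =>
      filter_upwards [hinv, (measurePreserving_smul_bern s).quasiMeasurePreserving.ae ih]
        with z h1 h2
      rw [pow_succ, mul_smul, h2, h1]
  have key : (bern G β).restrict E = bern G β E • bern G β := by
    refine ext_of_generate_finite _ (generateFrom_squareCylinders (α := fun _ : G => B)).symm
      isPiSystem_pi_finset ?_ (by simp)
    rintro _ ⟨F, t, ht, rfl⟩
    have ht' : ∀ g, MeasurableSet (t g) := fun g => ht g trivial
    have hD : MeasurableSet ((F : Set G).pi t) := .pi F.countable_toSet fun g _ => ht' g
    rw [Measure.restrict_apply hD, Measure.smul_apply, smul_eq_mul]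
    refine tendsto_nhds_unique (tendsto_const_nhds.congr fun n => ?_)
      (tendsto_bern_inter_preimage hs F ht' hE)
    rw [← (measurePreserving_smul_bern (s ^ n)).measure_preimage
      (hD.inter hE).nullMeasurableSet]
    refine measure_congr ?_
    filter_upwards [hinv' n] with z hz
    refine propext ?_
    change (s ^ n • z ∈ (F : Set G).pi t ∧ s ^ n • z ∈ E) ↔
      (z ∈ E ∧ s ^ n • z ∈ (F : Set G).pi t)
    rw [hz, and_comm]
  have h2 := congrArg (fun m : Measure (G → B) => m E) key
  simp only [Measure.restrict_apply hE, Set.inter_self, Measure.smul_apply, smul_eq_mul] at h2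
  have h1 : bern G β E = 1 := by
    have := (ENNReal.mul_eq_left hpos (measure_ne_top _ _)).mp h2.symm
    exact this
  exact (prob_compl_eq_zero_iff hE).mpr h1

end Bernoulli

/-! ### Products of Bernoulli spaces and collision arguments -/

section Products

variable {G : Type} {A B : Type} [MeasurableSpace A] [MeasurableSpace B]
  {α : Measure A} [IsProbabilityMeasure α] {β : Measure B} [IsProbabilityMeasure β]

theorem prod_univ_mem_squareCylinders :
    (Set.univ : Set (G → A)) ∈ squareCylinders fun _ : G => {t : Set A | MeasurableSet t} :=
  ⟨∅, fun _ => Set.univ, fun _ _ => MeasurableSet.univ, by simp⟩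

/-- The canonical identification of the Bernoulli space over a product with a product of
Bernoulli spaces. -/
theorem measurePreserving_unzip :
    MeasurePreserving (fun z : G → A × B => ((fun g => (z g).1 : G → A), (fun g => (z g).2 : G → B)))
      (bern G (α.prod β)) ((bern G α).prod (bern G β)) := by
  classical
  have hm : Measurable fun z : G → A × B =>
      ((fun g => (z g).1 : G → A), (fun g => (z g).2 : G → B)) := by fun_prop
  refine ⟨hm, ?_⟩
  symm
  refine Measure.prod_eq_generateFrom (generateFrom_squareCylinders (α := fun _ : G => A))
    (generateFrom_squareCylinders (α := fun _ : G => B))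
    isPiSystem_pi_finset isPiSystem_pi_finset
    ⟨fun _ => Set.univ, fun _ => prod_univ_mem_squareCylinders, fun _ => measure_lt_top _ _,
      Set.iUnion_const _⟩
    ⟨fun _ => Set.univ, fun _ => prod_univ_mem_squareCylinders, fun _ => measure_lt_top _ _,
      Set.iUnion_const _⟩ ?_
  rintro _ ⟨F, t, ht, rfl⟩ _ ⟨F', t', ht', rfl⟩
  replace ht : ∀ g, MeasurableSet (t g) := fun g => ht g trivial
  replace ht' : ∀ g, MeasurableSet (t' g) := fun g => ht' g trivial
  rw [Measure.map_apply hm ((MeasurableSet.pi F.countable_toSet fun g _ => ht g).prod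
    (.pi F'.countable_toSet fun g _ => ht' g))]
  have h : (fun z : G → A × B => ((fun g => (z g).1 : G → A), (fun g => (z g).2 : G → B))) ⁻¹'
      ((F : Set G).pi t ×ˢ (F' : Set G).pi t') =
      ((F ∪ F' : Finset G) : Set G).pi fun g =>
        (if g ∈ F then t g else Set.univ) ×ˢ (if g ∈ F' then t' g else Set.univ) := by
    ext z
    simp only [Set.mem_preimage, Set.mem_prod, Set.mem_pi, Finset.mem_coe, Finset.mem_union]
    constructor
    · rintro ⟨h1, h2⟩ g _
      constructor
      · split_ifs with h
        · exact h1 g h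
        · trivial
      · split_ifs with h
        · exact h2 g h
        · trivial
    · intro h
      exact ⟨fun g hg => by simpa [hg] using (h g (Or.inl hg)).1,
        fun g hg => by simpa [hg] using (h g (Or.inr hg)).2⟩
  rw [h, Measure.infinitePi_pi _ fun g _ => ?_, Measure.infinitePi_pi _ fun g _ => ht g,
    Measure.infinitePi_pi _ fun g _ => ht' g]
  · simp only [Measure.prod_prod]
    rw [Finset.prod_mul_distrib]
    congr 1
    · rw [← Finset.prod_subset (Finset.subset_union_left : F ⊆ F ∪ F')]
      · exact Finset.prod_congr rfl fun g hg => by simp [hg]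
      · intro g _ hg; simp [hg]
    · rw [← Finset.prod_subset (Finset.subset_union_right : F' ⊆ F ∪ F')]
      · exact Finset.prod_congr rfl fun g hg => by simp [hg]
      · intro g _ hg; simp [hg]
  · refine MeasurableSet.prod ?_ ?_ <;> split_ifs <;> simp [ht, ht']

theorem ae_mem_of_ae_comp_mem {Y Z : Type} [MeasurableSpace Y] [MeasurableSpace Z]
    {μ : Measure Y} {ν : Measure Z} {π : Y → Z} (hπ : MeasurePreserving π μ ν) {E : Set Z}
    (hE : MeasurableSet E) (h : ∀ᵐ y ∂μ, π y ∈ E) : ∀ᵐ z ∂ν, z ∈ E := by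
  rw [← hπ.map_eq]
  exact (ae_map_iff hπ.aemeasurable hE).mpr h

/-- Ergodicity passes to factors of Bernoulli spaces. -/
theorem ae_mem_of_factor [Group G] {s : G} (hs : ¬ IsOfFinOrder s) {Z : Type} [MeasurableSpace Z]
    {ν : Measure Z} {π : (G → B) → Z} (hπ : MeasurePreserving π (bern G β) ν) {T : Z → Z}
    (hT : ∀ z, π (s • z) = T (π z)) {E : Set Z} (hE : MeasurableSet E)
    (hinv : ∀ᵐ z ∂ν, T z ∈ E ↔ z ∈ E) (hpos : ν E ≠ 0) : ∀ᵐ z ∂ν, z ∈ E := by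
  refine ae_mem_of_ae_comp_mem hπ hE ?_
  refine ae_mem_of_smul_invariant (E := π ⁻¹' E) hs (hπ.measurable hE) ?_ ?_
  · filter_upwards [hπ.quasiMeasurePreserving.ae hinv] with z hz
    simpa [Set.mem_preimage, hT] using hz
  · rwa [hπ.measure_preimage hE.nullMeasurableSet]

variable {H : Type}

theorem exists_ae_eq_const {Y : Type} [MeasurableSpace Y] {ρ : Measure Y}
    [IsProbabilityMeasure ρ] {f : Y → H} (h : ∀ᵐ p ∂ρ.prod ρ, f p.1 = f p.2) :
    ∃ a, ∀ᵐ y ∂ρ, f y = a := by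
  obtain ⟨y, hy⟩ := (Measure.ae_ae_of_ae_prod h).exists
  exact ⟨f y, hy.mono fun y' h' => h'.symm⟩

variable [Countable H]

theorem exists_measure_fiber_ne_zero {Y : Type} [MeasurableSpace Y] {ρ : Measure Y} [NeZero ρ]
    (f : Y → H) : ∃ a, ρ {y | f y = a} ≠ 0 := by
  by_contra! h
  have : ρ (⋃ a, {y | f y = a}) = 0 := measure_iUnion_null h
  have hu : (⋃ a, {y | f y = a}) = Set.univ := by ext y; simp
  rw [hu] at this
  exact NeZero.ne ρ (Measure.measure_univ_eq_zero.mp this)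

variable [MeasurableSpace H] [DiscreteMeasurableSpace H]

theorem measurableSet_eq_fun_discrete {Y : Type} [MeasurableSpace Y] {f g : Y → H}
    (hf : Measurable f) (hg : Measurable g) : MeasurableSet {y | f y = g y} := by
  have : {y | f y = g y} = ⋃ a, {y | f y = a} ∩ {y | g y = a} := by
    ext y; simp [eq_comm]
  rw [this]
  exact MeasurableSet.iUnion fun a => (hf (MeasurableSet.of_discrete (s := {a}))).inter
    (hg (MeasurableSet.of_discrete (s := {a})))

/-- Two conditionally independent copies of a countably valued map coincide with positive
probability. -/
theorem measure_collision_ne_zero {X Y : Type} [MeasurableSpace X] [MeasurableSpace Y]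
    {μ : Measure X} [IsProbabilityMeasure μ] {ρ : Measure Y} [IsProbabilityMeasure ρ]
    {f : X × Y → H} (hf : Measurable f) :
    (μ.prod (ρ.prod ρ)) {p | f (p.1, p.2.1) = f (p.1, p.2.2)} ≠ 0 := by
  intro h0
  have hms : MeasurableSet {p : X × Y × Y | f (p.1, p.2.1) = f (p.1, p.2.2)} :=
    measurableSet_eq_fun_discrete (by fun_prop) (by fun_prop)
  rw [Measure.measure_prod_null hms] at h0
  obtain ⟨x, hx⟩ := h0.exists
  obtain ⟨a, ha⟩ := exists_measure_fiber_ne_zero (ρ := ρ) fun y => f (x, y)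
  have hsub : {y | f (x, y) = a} ×ˢ {y | f (x, y) = a} ⊆
      Prod.mk x ⁻¹' {p : X × Y × Y | f (p.1, p.2.1) = f (p.1, p.2.2)} := by
    rintro ⟨y, y'⟩ ⟨hy, hy'⟩
    exact Eq.trans hy (Eq.symm hy')
  have := measure_mono_null hsub hx
  rw [Measure.prod_prod] at this
  exact ha (mul_self_eq_zero.mp this)

variable [Group G] [Group H]

/-- A countably valued map that is conjugated by a constant under an element of infinite order is
constant. -/
theorem exists_ae_eq_const_of_conj {s : G} (hs : ¬ IsOfFinOrder s) {f : (G → A) → H}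
    (hf : Measurable f) {δ : H} (h : ∀ᵐ x ∂bern G α, f (s • x) * δ = δ * f x) :
    ∃ a, ∀ᵐ x ∂bern G α, f x = a := by
  refine exists_ae_eq_const (H := H) ?_
  have hE : MeasurableSet {p : (G → A) × (G → A) | f p.1 = f p.2} :=
    measurableSet_eq_fun_discrete (by fun_prop) (by fun_prop)
  refine ae_mem_of_factor (E := {p | f p.1 = f p.2}) hs measurePreserving_unzip
    (T := fun p : (G → A) × (G → A) => (s • p.1, s • p.2)) (fun z => rfl) hE ?_ ?_
  · have h1 : ∀ᵐ p ∂(bern G α).prod (bern G α), f (s • p.1) * δ = δ * f p.1 :=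
      measurePreserving_fst.quasiMeasurePreserving.ae h
    have h2 : ∀ᵐ p ∂(bern G α).prod (bern G α), f (s • p.2) * δ = δ * f p.2 :=
      measurePreserving_snd.quasiMeasurePreserving.ae h
    filter_upwards [h1, h2] with p h1 h2
    change f (s • p.1) = f (s • p.2) ↔ f p.1 = f p.2
    rw [← mul_left_inj δ, h1, h2, mul_right_inj]
  · have hpos := measure_collision_ne_zero (μ := Measure.dirac ()) (ρ := bern G α)
      (f := fun p : Unit × (G → A) => f p.2) (by fun_prop)
    intro h0
    apply hpos
    have := (measurePreserving_snd (μ := Measure.dirac ())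
      (ν := (bern G α).prod (bern G α))).measure_preimage hE.nullMeasurableSet
    rw [h0] at this
    exact this

/-- If a transfer function between two maps exists on the product of two Bernoulli spaces, then
the first of the two maps can be made constant. -/
theorem exists_untwist {s : G} (hs : ¬ IsOfFinOrder s) {c : (G → A) → H} {d : (G → B) → H}
    {Φ : (G → A) × (G → B) → H} (hΦ : Measurable Φ)
    (h : ∀ᵐ p ∂(bern G α).prod (bern G β), c p.1 * Φ p = Φ (s • p.1, s • p.2) * d p.2) :
    ∃ a : (G → A) → H, Measurable a ∧ ∃ δ, ∀ᵐ x ∂bern G α, (a (s • x))⁻¹ * c x * a x = δ := by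
  have hE : MeasurableSet {q : ((G → B) × (G → B)) × ((G → A) × (G → A)) |
      (Φ (q.2.1, q.1.2))⁻¹ * Φ (q.2.1, q.1.1) = (Φ (q.2.2, q.1.2))⁻¹ * Φ (q.2.2, q.1.1)} :=
    measurableSet_eq_fun_discrete (by fun_prop) (by fun_prop)
  have key : ∀ᵐ q ∂((bern G β).prod (bern G β)).prod ((bern G α).prod (bern G α)),
      (Φ (q.2.1, q.1.2))⁻¹ * Φ (q.2.1, q.1.1) = (Φ (q.2.2, q.1.2))⁻¹ * Φ (q.2.2, q.1.1) := by
    have hπ := (measurePreserving_unzip (G := G) (α := β) (β := β)).prod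
      (measurePreserving_unzip (G := G) (α := α) (β := α))
    refine ae_mem_of_factor (E := {q | (Φ (q.2.1, q.1.2))⁻¹ * Φ (q.2.1, q.1.1) =
      (Φ (q.2.2, q.1.2))⁻¹ * Φ (q.2.2, q.1.1)}) hs (hπ.comp measurePreserving_unzip)
      (T := fun q => ((s • q.1.1, s • q.1.2), (s • q.2.1, s • q.2.2))) (fun z => rfl) hE ?_ ?_
    · have hc (i : Bool) (j : Bool) :
          ∀ᵐ q ∂((bern G β).prod (bern G β)).prod ((bern G α).prod (bern G α)),
          c (if i then q.2.1 else q.2.2) *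
            Φ (if i then q.2.1 else q.2.2, if j then q.1.1 else q.1.2) =
          Φ (s • (if i then q.2.1 else q.2.2), s • (if j then q.1.1 else q.1.2)) *
            d (if j then q.1.1 else q.1.2) := by
        have hi : MeasurePreserving (fun q : (G → A) × (G → A) => if i then q.1 else q.2)
            ((bern G α).prod (bern G α)) (bern G α) := by
          cases i
          · exact measurePreserving_snd
          · exact measurePreserving_fst
        have hj : MeasurePreserving (fun q : (G → B) × (G → B) => if j then q.1 else q.2)
            ((bern G β).prod (bern G β)) (bern G β) := by
          cases j
          · exact measurePreserving_snd
          · exact measurePreserving_fst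
        have := (Measure.measurePreserving_swap.comp (hj.prod hi)).quasiMeasurePreserving.ae h
        exact this
      filter_upwards [hc true true, hc true false, hc false true, hc false false]
        with q h1 h2 h3 h4
      simp only [if_true, Bool.false_eq_true, if_false] at h1 h2 h3 h4
      rw [eq_mul_inv_of_mul_eq h1.symm, eq_mul_inv_of_mul_eq h2.symm,
        eq_mul_inv_of_mul_eq h3.symm, eq_mul_inv_of_mul_eq h4.symm]
      simp only [mul_inv_rev, inv_inv, mul_assoc, inv_mul_cancel_left, mul_right_inj]
      simp only [← mul_assoc, mul_left_inj]
    · exact measure_collision_ne_zero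
        (f := fun p : ((G → B) × (G → B)) × (G → A) => (Φ (p.2, p.1.2))⁻¹ * Φ (p.2, p.1.1))
        (by fun_prop)
  obtain ⟨v', hv'⟩ := (Measure.ae_ae_of_ae_prod (Measure.ae_ae_of_ae_prod key)).exists
  refine ⟨fun x => Φ (x, v'), by fun_prop, ?_⟩
  have hκ : ∀ᵐ v ∂bern G β, ∃ κ, ∀ᵐ x ∂bern G α, (Φ (x, v))⁻¹ * Φ (x, v') = κ :=
    hv'.mono fun v hv => exists_ae_eq_const (H := H) hv
  have hκs := (measurePreserving_smul_bern (β := β) s).quasiMeasurePreserving.ae hκ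
  have hsw : ∀ᵐ v ∂bern G β, ∀ᵐ x ∂bern G α, c x * Φ (x, v) = Φ (s • x, s • v) * d v :=
    Measure.ae_ae_of_ae_prod (Measure.measurePreserving_swap.quasiMeasurePreserving.ae h)
  obtain ⟨v, ⟨κ, h1⟩, ⟨κ', h2⟩, h3⟩ := (hκ.and (hκs.and hsw)).exists
  refine ⟨κ'⁻¹ * d v * κ, ?_⟩
  filter_upwards [h1, (measurePreserving_smul_bern (β := α) s).quasiMeasurePreserving.ae h2, h3]
    with x h1 h2 h3
  rw [inv_mul_eq_iff_eq_mul] at h1 h2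
  rw [h1, h2, mul_inv_rev, ← mul_assoc, mul_assoc _ (c x), h3]
  group

end Products

/-! ### Almost invariant indicators and transfer functions -/

section Transfer

theorem lintegral_enorm_sq_eq_enorm_sq {M : Type} [MeasurableSpace M] {m : Measure M}
    {E : Type} [NormedAddCommGroup E] (f : Lp E 2 m) : ∫⁻ p, ‖f p‖ₑ ^ 2 ∂m = ‖f‖ₑ ^ 2 := by
  have h := eLpNorm_nnreal_pow_eq_lintegral (f := (f : M → E)) (μ := m) (p := 2) two_ne_zero
  rw [Lp.enorm_def]
  simpa using h.symm

/-- By the mean ergodic theorem, an indicator function that is moved little by all iterates of a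
measure preserving map is close to an invariant function. -/
theorem exists_invariant_near_indicator {M : Type} [MeasurableSpace M] {m : Measure M} {S : M → M}
    (hS : MeasurePreserving S m m) {E : Set M} (hE : MeasurableSet E) (hEm : m E ≠ ∞) {ε : ℝ}
    (h : ∀ n : ℕ, m.real E - ε ≤ m.real (S^[n] ⁻¹' E ∩ E)) :
    ∃ ξ : M → ℝ, Measurable ξ ∧ (∀ᵐ p ∂m, ξ (S p) = ξ p) ∧
      ∫⁻ p, ‖ξ p - E.indicator 1 p‖ₑ ^ 2 ∂m ≤ ENNReal.ofReal (2 * ε) := by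
  let U : Lp ℝ 2 m →ₗᵢ[ℝ] Lp ℝ 2 m := Lp.compMeasurePreservingₗᵢ ℝ S hS
  let g : Lp ℝ 2 m := indicatorConstLp 2 hE hEm 1
  have hfin (n : ℕ) : m (S^[n] ⁻¹' E) ≠ ∞ := by
    rwa [(hS.iterate n).measure_preimage hE.nullMeasurableSet]
  have hUn (n : ℕ) : U^[n] g =
      indicatorConstLp 2 ((hS.iterate n).measurable hE) (hfin n) 1 := by
    have := congrFun (Lp.compMeasurePreserving_iterate (E := ℝ) (p := 2) hS n) g
    refine Eq.trans this ?_
    exact Lp.indicatorConstLp_compMeasurePreserving hE hEm 1 (hS.iterate n)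
  have hdist (n : ℕ) : ‖U^[n] g - g‖ ^ 2 ≤ 2 * ε := by
    have hn := h n
    rw [← real_inner_self_eq_norm_sq, inner_sub_left, inner_sub_right, inner_sub_right, hUn,
      L2.real_inner_indicatorConstLp_one_indicatorConstLp_one (hμs := hfin n) (hμt := hfin n),
      L2.real_inner_indicatorConstLp_one_indicatorConstLp_one (hμs := hfin n) (hμt := hEm),
      L2.real_inner_indicatorConstLp_one_indicatorConstLp_one (hμs := hEm) (hμt := hfin n),
      L2.real_inner_indicatorConstLp_one_indicatorConstLp_one (hμs := hEm) (hμt := hEm),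
      Set.inter_self, Set.inter_self,
      measureReal_def m (_ ⁻¹' E), (hS.iterate n).measure_preimage hE.nullMeasurableSet,
      Set.inter_comm E, ← measureReal_def]
    linarith
  have hε : 0 ≤ 2 * ε := (sq_nonneg _).trans (hdist 0)
  have hU : ‖U.toContinuousLinearMap‖ ≤ 1 := U.norm_toContinuousLinearMap_le
  have hlim := U.toContinuousLinearMap.tendsto_birkhoffAverage_orthogonalProjection hU g
  set ξ := ((U.toContinuousLinearMap.eqLocus
    (1 : Lp ℝ 2 m →L[ℝ] Lp ℝ 2 m)).orthogonalProjectionOnto g) with hξ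
  have hinv : U (ξ : Lp ℝ 2 m) = ξ := ξ.2
  have hclose : ‖(ξ : Lp ℝ 2 m) - g‖ ≤ √(2 * ε) := by
    refine le_of_tendsto (hlim.sub_const g).norm ?_
    filter_upwards [Filter.eventually_gt_atTop 0] with N hN
    have hN' : (0 : ℝ) < N := by exact_mod_cast hN
    have : birkhoffAverage ℝ U.toContinuousLinearMap _root_.id N g - g =
        (N : ℝ)⁻¹ • ∑ n ∈ Finset.range N, (U^[n] g - g) := by
      rw [Finset.sum_sub_distrib, smul_sub, Finset.sum_const, Finset.card_range,
        ← Nat.cast_smul_eq_nsmul ℝ, inv_smul_smul₀ hN'.ne']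
      rfl
    rw [this, norm_smul, norm_inv, Real.norm_natCast, inv_mul_le_iff₀ hN']
    refine (norm_sum_le_of_le _ fun n _ => Real.le_sqrt_of_sq_le (hdist n)).trans ?_
    simp
  refine ⟨(ξ : Lp ℝ 2 m), (Lp.stronglyMeasurable _).measurable, ?_, ?_⟩
  · have h1 := Lp.coeFn_compMeasurePreserving (ξ : Lp ℝ 2 m) hS
    have h2 : Lp.compMeasurePreserving S hS (ξ : Lp ℝ 2 m) = ξ := hinv
    rw [h2] at h1
    exact h1.mono fun p hp => hp.symm
  · have hae : (fun p => ‖(ξ : Lp ℝ 2 m) p - E.indicator 1 p‖ₑ ^ 2) =ᵐ[m]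
        fun p => ‖((ξ : Lp ℝ 2 m) - g) p‖ₑ ^ 2 := by
      filter_upwards [Lp.coeFn_sub (ξ : Lp ℝ 2 m) g,
        indicatorConstLp_coeFn (p := 2) (hs := hE) (hμs := hEm) (c := (1 : ℝ))] with p h1 h2
      rw [h1, Pi.sub_apply, h2]
      rfl
    rw [lintegral_congr_ae hae, lintegral_enorm_sq_eq_enorm_sq,
      ← ofReal_norm, ← ENNReal.ofReal_pow (norm_nonneg _)]
    refine ENNReal.ofReal_le_ofReal ?_
    calc _ ≤ √(2 * ε) ^ 2 := by gcongr
      _ = _ := Real.sq_sqrt hε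

theorem half_le_tsum_enorm_sub_sq {H : Type} [DecidableEq H] {a₀ : H} {f : H → ℝ}
    (hf : 2 * ‖f a₀‖ₑ ^ 2 ≤ ∑' a, ‖f a‖ₑ ^ 2) :
    2⁻¹ ≤ ∑' a, ‖f a - if a = a₀ then 1 else 0‖ₑ ^ 2 := by
  have hreal : (2⁻¹ : ℝ) ≤ ‖f a₀ - 1‖ ^ 2 + ‖f a₀‖ ^ 2 := by
    rw [Real.norm_eq_abs, Real.norm_eq_abs, sq_abs, sq_abs]
    nlinarith [sq_nonneg (2 * f a₀ - 1)]
  have h1 : (2⁻¹ : ℝ≥0∞) ≤ ‖f a₀ - 1‖ₑ ^ 2 + ‖f a₀‖ₑ ^ 2 := by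
    rw [← ofReal_norm, ← ofReal_norm, ← ENNReal.ofReal_pow (norm_nonneg _),
      ← ENNReal.ofReal_pow (norm_nonneg _), ← ENNReal.ofReal_add (by positivity) (by positivity)]
    refine le_trans (le_of_eq ?_) (ENNReal.ofReal_le_ofReal hreal)
    rw [ENNReal.ofReal_inv_of_pos two_pos, ENNReal.ofReal_ofNat]
  refine h1.trans ?_
  rw [ENNReal.tsum_eq_add_tsum_ite a₀, if_pos rfl]
  gcongr
  rw [ENNReal.tsum_eq_add_tsum_ite a₀, two_mul] at hf
  refine ((ENNReal.add_le_add_iff_left (by finiteness)).mp hf).trans (le_of_eq ?_)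
  refine tsum_congr fun a => ?_
  split_ifs <;> simp

/-- Two maps whose iterated twists agree with high probability at all times are intertwined by a
transfer function. -/
theorem exists_transfer {Ω : Type} [MeasurableSpace Ω] {P : Measure Ω} [IsProbabilityMeasure P]
    {T : Ω → Ω} (hT : MeasurePreserving T P P)
    (hErg : ∀ E : Set Ω, MeasurableSet E → (∀ᵐ z ∂P, T z ∈ E ↔ z ∈ E) → P E ≠ 0 →
      ∀ᵐ z ∂P, z ∈ E)
    {H : Type} [MeasurableSpace H] [DiscreteMeasurableSpace H] [Countable H] [Group H]
    {u v : Ω → H} (hu : Measurable u) (hv : Measurable v) {un vn : ℕ → Ω → H}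
    (hunm : ∀ n, Measurable (un n)) (hvnm : ∀ n, Measurable (vn n))
    (hun₀ : ∀ᵐ z ∂P, un 0 z = 1) (hvn₀ : ∀ᵐ z ∂P, vn 0 z = 1)
    (hun : ∀ n, ∀ᵐ z ∂P, un (n + 1) z = un n (T z) * u z)
    (hvn : ∀ n, ∀ᵐ z ∂P, vn (n + 1) z = vn n (T z) * v z) {ε : ℝ} (hε : 4 * ε < 1)
    (h : ∀ n, 1 - ε ≤ P.real {z | un n z = vn n z}) :
    ∃ φ : Ω → H, Measurable φ ∧ ∀ᵐ z ∂P, u z * φ z = φ (T z) * v z := by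
  classical
  let S : Ω × H → Ω × H := fun p => (T p.1, u p.1 * p.2 * (v p.1)⁻¹)
  have hS : MeasurePreserving S (P.prod Measure.count) (P.prod Measure.count) := by
    refine hT.skew_product (g := fun z a => u z * a * (v z)⁻¹) (by fun_prop)
      (Filter.Eventually.of_forall fun z => ?_)
    have he := ((Equiv.mulLeft (u z)).trans (Equiv.mulRight (v z)⁻¹)).bijective
    refine Measure.ext fun s _ => ?_
    rw [Measure.map_apply (by fun_prop) .of_discrete, ← Measure.count_injective_image he.injective]
    exact congrArg _ (Set.image_preimage_eq s he.surjective)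
  have hiter (n : ℕ) : ∀ᵐ z ∂P, ∀ a, (S^[n] (z, a)).2 = un n z * a * (vn n z)⁻¹ := by
    induction n with
    | zero => filter_upwards [hun₀, hvn₀] with z h1 h2 a; simp [h1, h2]
    | succ n ih =>
      filter_upwards [hun n, hvn n, hT.quasiMeasurePreserving.ae ih] with z h1 h2 h3 a
      rw [Function.iterate_succ_apply, h3, h1, h2, mul_inv_rev]
      simp only [mul_assoc]
  let E : Set (Ω × H) := {p | p.2 = 1}
  have hE : MeasurableSet E := measurable_snd (MeasurableSet.of_discrete (s := {1}))
  have hEprod : E = Set.univ ×ˢ {1} := by ext p; simp [E]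
  have hEm : (P.prod Measure.count) E = 1 := by
    rw [hEprod, Measure.prod_prod]; simp
  obtain ⟨ξ, hξm, hξinv, hξ⟩ := exists_invariant_near_indicator hS hE (by simp [hEm]) (ε := ε)
    fun n => by
    have hSn : MeasurableSet (S^[n] ⁻¹' E ∩ E) := ((hS.iterate n).measurable hE).inter hE
    have hEq : (P.prod Measure.count).real (S^[n] ⁻¹' E ∩ E) = P.real {z | un n z = vn n z} := by
      rw [measureReal_def, measureReal_def, Measure.prod_apply hSn]
      congr 1
      have hpt : ∀ᵐ z ∂P, Measure.count (Prod.mk z ⁻¹' (S^[n] ⁻¹' E ∩ E)) =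
          {z | un n z = vn n z}.indicator 1 z := by
        filter_upwards [hiter n] with z hz
        have : Prod.mk z ⁻¹' (S^[n] ⁻¹' E ∩ E) = if un n z = vn n z then {1} else ∅ := by
          ext a
          change (S^[n] (z, a)).2 = 1 ∧ a = 1 ↔ _
          rw [hz]
          split_ifs with h
          · rw [Set.mem_singleton_iff]
            exact ⟨fun h => h.2, by rintro rfl; simp [h]⟩
          · refine iff_of_false ?_ (Set.notMem_empty a)
            rintro ⟨h1, rfl⟩
            exact h (by rwa [mul_one, mul_inv_eq_one] at h1)
        rw [this, Set.indicator_apply]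
        simp only [Set.mem_ofPred_eq]
        split_ifs <;> simp
      rw [lintegral_congr_ae hpt,
        lintegral_indicator_one (measurableSet_eq_fun_discrete (hunm n) (hvnm n))]
    rw [hEq, measureReal_def, hEm]
    exact h n
  let N : Ω → ℝ≥0∞ := fun z => ∑' a, ‖ξ (z, a)‖ₑ ^ 2
  have hN : Measurable N := by
    refine Measurable.tsum fun a => ?_
    fun_prop
  let Q : Ω → H → Prop := fun z a => N z < 2 * ‖ξ (z, a)‖ₑ ^ 2
  have hQm (a : H) : MeasurableSet {z | Q z a} := measurableSet_lt hN (by fun_prop)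
  have hQu (z : Ω) (a b : H) (ha : Q z a) (hb : Q z b) : a = b := by
    by_contra hab
    have h2 : ‖ξ (z, a)‖ₑ ^ 2 + ‖ξ (z, b)‖ₑ ^ 2 ≤ N z := by
      rw [← Finset.sum_pair (f := fun c => ‖ξ (z, c)‖ₑ ^ 2) hab]
      exact ENNReal.sum_le_tsum _
    have := ENNReal.add_lt_add ha hb
    rw [← two_mul, ← mul_add] at this
    exact absurd (mul_le_mul_right h2 2) (not_le.mpr this)
  have hinv : ∀ᵐ z ∂P, ∀ a, ξ (T z, u z * a * (v z)⁻¹) = ξ (z, a) :=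
    (Measure.ae_ae_of_ae_prod hξinv).mono fun z hz => Measure.ae_count_iff.mp hz
  have hQinv : ∀ᵐ z ∂P, ∀ a, Q (T z) (u z * a * (v z)⁻¹) ↔ Q z a := by
    filter_upwards [hinv] with z hz a
    have hNz : N (T z) = N z := by
      refine ((Equiv.mulLeft (u z)).trans (Equiv.mulRight (v z)⁻¹)).tsum_eq
        (fun b => ‖ξ (T z, b)‖ₑ ^ 2) |>.symm.trans ?_
      exact tsum_congr fun a => by simp [hz a]
    simp only [Q, hNz, hz a]
  have hR : ∀ᵐ z ∂P, z ∈ {z | ∃ a, Q z a} := by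
    refine hErg _ ?_ ?_ ?_
    · rw [Set.ofPred_exists]
      exact MeasurableSet.iUnion hQm
    · filter_upwards [hQinv] with z hz
      constructor
      · rintro ⟨b, hb⟩
        refine ⟨(u z)⁻¹ * b * v z, (hz _).mp ?_⟩
        convert hb using 1
        group
      · rintro ⟨a, ha⟩
        exact ⟨_, (hz a).mpr ha⟩
    · intro h0
      have hnot : ∀ᵐ z ∂P, ¬ ∃ a, Q z a := measure_eq_zero_iff_ae_notMem.mp h0
      rw [lintegral_prod _ (by fun_prop)] at hξ
      have hlow : (2⁻¹ : ℝ≥0∞) ≤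
          ∫⁻ z, ∫⁻ a, ‖ξ (z, a) - E.indicator 1 (z, a)‖ₑ ^ 2 ∂Measure.count ∂P := by
        calc (2⁻¹ : ℝ≥0∞) = ∫⁻ z, 2⁻¹ ∂P := by simp
          _ ≤ _ := by
            refine lintegral_mono_ae (hnot.mono fun z hz => ?_)
            rw [lintegral_count]
            have hz1 : 2 * ‖ξ (z, 1)‖ₑ ^ 2 ≤ N z := not_lt.mp fun h => hz ⟨1, h⟩
            refine (half_le_tsum_enorm_sub_sq (f := fun a => ξ (z, a)) hz1).trans
              (le_of_eq (tsum_congr fun a => ?_))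
            rfl
      have := hlow.trans hξ
      rw [show (2⁻¹ : ℝ≥0∞) = ENNReal.ofReal 2⁻¹ by
        rw [ENNReal.ofReal_inv_of_pos two_pos, ENNReal.ofReal_ofNat],
        ENNReal.ofReal_le_ofReal_iff' ] at this
      rcases this with h | h <;> linarith
  refine ⟨fun z => if hz : ∃ a, Q z a then hz.choose else 1, ?_, ?_⟩
  · refine measurable_to_countable' fun a => ?_
    have : (fun z => if hz : ∃ a, Q z a then hz.choose else 1) ⁻¹' {a} =
        {z | Q z a} ∪ if a = 1 then (⋃ b, {z | Q z b})ᶜ else ∅ := by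
      ext z
      simp only [Set.mem_preimage, Set.mem_singleton_iff, Set.mem_union]
      by_cases hz : ∃ a, Q z a
      · rw [dif_pos hz]
        constructor
        · rintro rfl
          exact Or.inl hz.choose_spec
        · rintro (h | h)
          · exact hQu _ _ _ hz.choose_spec h
          · split_ifs at h
            · exact absurd (Set.mem_iUnion (s := fun b => {z | Q z b}).mpr hz) h
            · exact absurd h (Set.notMem_empty z)
      · rw [dif_neg hz]
        constructor
        · rintro rfl
          rw [if_pos rfl]
          exact Or.inr fun h => hz (Set.mem_iUnion (s := fun b => {z | Q z b}).mp h)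
        · rintro (h | h)
          · exact absurd ⟨a, h⟩ hz
          · split_ifs at h with ha
            · exact ha.symm
            · exact absurd h (Set.notMem_empty z)
    rw [this]
    refine (hQm a).union ?_
    split_ifs
    · exact (MeasurableSet.iUnion hQm).compl
    · exact MeasurableSet.empty
  · filter_upwards [hR, hT.quasiMeasurePreserving.ae hR, hQinv] with z hz hTz hq
    rw [dif_pos hz, dif_pos hTz]
    rw [hQu _ _ _ hTz.choose_spec ((hq _).mpr hz.choose_spec)]
    group

end Transfer

/-! ### Fourier analysis on the Bernoulli space over the circle -/

section Fourier

open AddCircle ComplexConjugate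

/-- The normalised Haar measure of the circle. -/
noncomputable abbrev circleMeasure : Measure UnitAddCircle := haarAddCircle

/-- The character of `G → ℝ/ℤ` with exponents `T`. -/
noncomputable def torusChar {G : Type} (T : G →₀ ℤ) : C(G → UnitAddCircle, ℂ) where
  toFun w := toCircle (T.sum fun g n => n • w g)
  continuous_toFun := by
    refine continuous_induced_dom.comp (continuous_toCircle.comp ?_)
    exact continuous_finsetSum _ fun g _ => (continuous_zsmul _).comp (continuous_apply g)

theorem torusChar_apply {G : Type} (T : G →₀ ℤ) (w : G → UnitAddCircle) :
    torusChar T w = toCircle (T.sum fun g n => n • w g) := rfl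

theorem norm_torusChar {G : Type} (T : G →₀ ℤ) (w : G → UnitAddCircle) : ‖torusChar T w‖ = 1 :=
  Circle.norm_coe _

theorem torusChar_zero {G : Type} : torusChar (0 : G →₀ ℤ) = 1 := by
  ext w
  simp [torusChar_apply]

theorem torusChar_add {G : Type} (T T' : G →₀ ℤ) :
    torusChar (T + T') = torusChar T * torusChar T' := by
  classical
  ext w
  rw [ContinuousMap.mul_apply, torusChar_apply, torusChar_apply, torusChar_apply,
    Finsupp.sum_add_index' (fun g => zero_smul ℤ (w g)) (fun g m n => add_smul m n (w g)),
    toCircle_add, Circle.coe_mul]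

theorem torusChar_neg {G : Type} (T : G →₀ ℤ) : torusChar (-T) = star (torusChar T) := by
  ext w
  rw [ContinuousMap.star_apply, torusChar_apply, torusChar_apply,
    Finsupp.sum_neg_index fun g => zero_smul ℤ (w g)]
  simp only [neg_smul, Finsupp.sum_neg, toCircle_neg]
  exact Circle.coe_inv_eq_conj _

theorem torusChar_single {G : Type} (g : G) (n : ℤ) (w : G → UnitAddCircle) :
    torusChar (Finsupp.single g n) w = fourier n (w g) := by
  rw [torusChar_apply, Finsupp.sum_single_index (zero_smul ℤ (w g)), fourier_apply]

theorem span_torusChar_topologicalClosure {G : Type} :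
    (Submodule.span ℂ (Set.range (torusChar (G := G)))).topologicalClosure = ⊤ := by
  let 𝒜 : StarSubalgebra ℂ C(G → UnitAddCircle, ℂ) :=
    { toSubalgebra := Algebra.adjoin ℂ (Set.range torusChar)
      star_mem' := by
        change Algebra.adjoin ℂ (Set.range (torusChar (G := G))) ≤
          star (Algebra.adjoin ℂ (Set.range (torusChar (G := G))))
        refine Algebra.adjoin_le ?_
        rintro - ⟨T, rfl⟩
        exact Algebra.subset_adjoin ⟨-T, torusChar_neg T⟩ }
  have hspan : Subalgebra.toSubmodule 𝒜.toSubalgebra =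
      Submodule.span ℂ (Set.range (torusChar (G := G))) := by
    refine Algebra.adjoin_eq_span_of_subset _ (Set.Subset.trans ?_ Submodule.subset_span)
    intro x hx
    refine Submonoid.closure_induction (fun _ => id) ⟨0, torusChar_zero⟩ ?_ hx
    rintro - - - - ⟨m, rfl⟩ ⟨n, rfl⟩
    exact ⟨m + n, torusChar_add m n⟩
  have hsep : 𝒜.SeparatesPoints := by
    intro x y hxy
    obtain ⟨g, hg⟩ := Function.ne_iff.mp hxy
    refine ⟨_, ⟨torusChar (Finsupp.single g 1), Algebra.subset_adjoin ⟨_, rfl⟩, rfl⟩, ?_⟩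
    simp only [torusChar_single, fourier_one]
    contrapose! hg
    exact injective_toCircle one_ne_zero (Circle.coe_injective hg)
  rw [← hspan]
  exact congrArg (fun B : StarSubalgebra ℂ C(G → UnitAddCircle, ℂ) =>
    Subalgebra.toSubmodule B.toSubalgebra)
    (ContinuousMap.starSubalgebra_topologicalClosure_eq_top_of_separatesPoints 𝒜 hsep)

variable {G : Type} [Countable G]

theorem integral_torusChar {T : G →₀ ℤ} (hT : T ≠ 0) :
    ∫ w, torusChar T w ∂bern G circleMeasure = 0 := by
  classical
  obtain ⟨g, hg⟩ := Finsupp.ne_iff.mp hT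
  let t : G → UnitAddCircle := Pi.single g (((1 : ℝ) / 2 / (T g) : ℝ) : UnitAddCircle)
  have htr : MeasurePreserving (fun w : G → UnitAddCircle => fun h => w h + t h)
      (bern G circleMeasure) (bern G circleMeasure) := by
    refine ⟨by fun_prop, ?_⟩
    refine (Measure.infinitePi_map_pi (fun _ : G => circleMeasure)
      (f := fun h (x : UnitAddCircle) => x + t h) (fun h => by fun_prop)).trans ?_
    congr 1
    funext h
    exact map_add_right_eq_self _ _
  have hval (w : G → UnitAddCircle) : torusChar T (fun h => w h + t h) = - torusChar T w := by
    have hsplit : (T.sum fun h n => n • (w h + t h)) =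
        (T.sum fun h n => n • w h) + T g • t g := by
      simp only [smul_add, Finsupp.sum_add]
      congr 1
      refine Finsupp.sum_eq_single g (fun h _ hh => ?_) (fun _ => zero_smul ℤ _)
      simp [t, Pi.single_eq_of_ne hh]
    have hhalf : (toCircle (T g • t g) : ℂ) = -1 := by
      have hTg : ((T g : ℤ) : ℂ) ≠ 0 := by exact_mod_cast hg
      simp only [t, Pi.single_eq_same]
      rw [← fourier_apply, fourier_coe_apply]
      have : 2 * (Real.pi : ℂ) * Complex.I * (T g : ℂ) * ((1 / 2 / (T g : ℝ) : ℝ) : ℂ) / ((1 : ℝ) : ℂ) =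
          Real.pi * Complex.I := by
        push_cast
        field_simp
      rw [this, Complex.exp_pi_mul_I]
    rw [torusChar_apply, torusChar_apply, hsplit, toCircle_add, Circle.coe_mul, hhalf, mul_neg_one]
  have h : ∫ w, torusChar T (fun h => w h + t h) ∂bern G circleMeasure =
      ∫ w, torusChar T w ∂bern G circleMeasure := by
    conv_rhs => rw [← htr.map_eq]
    exact (integral_map htr.aemeasurable
      (torusChar T).continuous.measurable.aestronglyMeasurable).symm
  simp only [hval, integral_neg] at h
  exact self_eq_neg.mp h.symm

theorem orthonormal_torusChar : Orthonormal ℂ fun T : G →₀ ℤ =>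
    ContinuousMap.toLp (E := ℂ) 2 (bern G circleMeasure) ℂ (torusChar T) := by
  classical
  rw [orthonormal_iff_ite]
  intro T T'
  rw [ContinuousMap.inner_toLp]
  have h (w : G → UnitAddCircle) : torusChar T' w * conj (torusChar T w) = torusChar (T' - T) w := by
    rw [sub_eq_add_neg, torusChar_add, torusChar_neg]
    rfl
  simp only [h]
  split_ifs with hTT
  · subst hTT
    simp [torusChar_zero]
  · exact integral_torusChar (sub_ne_zero.mpr (Ne.symm hTT))

/-- Parseval's identity on the Bernoulli space over the circle. -/
theorem tsum_enorm_integral_torusChar_sq {u : (G → UnitAddCircle) → ℂ}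
    (hu : MemLp u 2 (bern G circleMeasure)) :
    ∑' T : G →₀ ℤ, ‖∫ w, u w * conj (torusChar T w) ∂bern G circleMeasure‖ₑ ^ 2 =
      ∫⁻ w, ‖u w‖ₑ ^ 2 ∂bern G circleMeasure := by
  have hdense : (Submodule.span ℂ (Set.range fun T : G →₀ ℤ =>
      ContinuousMap.toLp (E := ℂ) 2 (bern G circleMeasure) ℂ (torusChar T))).topologicalClosure =
      ⊤ := by
    convert! (ContinuousMap.toLp_denseRange ℂ (bern G circleMeasure) ℂ
      (p := 2) (by simp)).topologicalClosure_map_submodule span_torusChar_topologicalClosure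
    rw [Submodule.map_span, ← Set.range_comp]
    rfl
  let b := HilbertBasis.mk orthonormal_torusChar hdense.ge
  have hb (T : G →₀ ℤ) : b T = ContinuousMap.toLp (E := ℂ) 2 (bern G circleMeasure) ℂ (torusChar T) :=
    congrFun (HilbertBasis.coe_mk _ _) T
  have hcoef (T : G →₀ ℤ) : inner ℂ (b T) (hu.toLp u) =
      ∫ w, u w * conj (torusChar T w) ∂bern G circleMeasure := by
    rw [hb, L2.inner_def]
    refine integral_congr_ae ?_
    filter_upwards [hu.coeFn_toLp, ContinuousMap.coeFn_toLp (p := 2) (𝕜 := ℂ)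
      (bern G circleMeasure) (torusChar T)] with w h1 h2
    rw [h1, h2]
    rfl
  have hsum : HasSum (fun T => ‖inner ℂ (b T) (hu.toLp u)‖ ^ 2) (‖hu.toLp u‖ ^ 2) := by
    have := RCLike.hasSum_re ℂ (b.hasSum_inner_mul_inner (hu.toLp u) (hu.toLp u))
    rw [inner_self_eq_norm_sq_to_K] at this
    convert this using 1
    · funext T
      rw [inner_mul_symm_re_eq_norm, norm_mul, norm_inner_symm, sq]
    · norm_cast
  have h1 : ∫⁻ w, ‖u w‖ₑ ^ 2 ∂bern G circleMeasure = ‖hu.toLp u‖ₑ ^ 2 := by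
    rw [← lintegral_enorm_sq_eq_enorm_sq]
    exact lintegral_congr_ae (hu.coeFn_toLp.mono fun w hw => by simp only [hw])
  rw [h1, ← ofReal_norm, ← ENNReal.ofReal_pow (norm_nonneg _), ← hsum.tsum_eq,
    ENNReal.ofReal_tsum_of_nonneg (fun T => by positivity) hsum.summable]
  refine tsum_congr fun T => ?_
  rw [hcoef, ENNReal.ofReal_pow (norm_nonneg _), ofReal_norm]

end Fourier

section FourierMass

open ComplexConjugate

variable {G : Type} {H : Type}

open Classical in
/-- The indicator function of a level set, as a complex-valued function. -/
noncomputable def levelInd {W : Type} (e : W → H) (a : H) (w : W) : ℂ := if e w = a then 1 else 0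

/-- The Fourier coefficient at `T` of the level set `{e = a}`. -/
noncomputable def levelCoef (e : (G → UnitAddCircle) → H) (a : H) (T : G →₀ ℤ) : ℂ :=
  ∫ w, levelInd e a w * conj (torusChar T w) ∂bern G circleMeasure

/-- The squared length of the Fourier coefficient at `T` of an `H`-valued map `e`, viewed as an
`ℓ²(H)`-valued map. -/
noncomputable def fourierMass (e : (G → UnitAddCircle) → H) (T : G →₀ ℤ) : ℝ≥0∞ :=
  ∑' a, ‖levelCoef e a T‖ₑ ^ 2

theorem norm_levelInd_le {W : Type} (e : W → H) (a : H) (w : W) : ‖levelInd e a w‖ ≤ 1 := by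
  unfold levelInd
  split_ifs <;> simp

theorem enorm_levelInd_sq {W : Type} (e : W → H) (a : H) (w : W) :
    ‖levelInd e a w‖ₑ ^ 2 = Set.indicator {w | e w = a} 1 w := by
  classical
  by_cases h : e w = a <;> simp [levelInd, h]

theorem measurable_levelInd {W : Type} [MeasurableSpace W] [MeasurableSpace H]
    [DiscreteMeasurableSpace H] {e : W → H} (he : Measurable e) (a : H) :
    Measurable (levelInd e a) :=
  Measurable.ite (he (MeasurableSet.of_discrete (s := {a}))) measurable_const measurable_const

theorem fourierMass_mul_mul [Group H] (e : (G → UnitAddCircle) → H) (α β : H) (T : G →₀ ℤ) :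
    fourierMass (fun w => α * e w * β) T = fourierMass e T := by
  unfold fourierMass
  rw [← ((Equiv.mulLeft α).trans (Equiv.mulRight β)).tsum_eq]
  refine tsum_congr fun a => ?_
  have h (w : G → UnitAddCircle) :
      levelInd (fun w => α * e w * β) (α * a * β) w = levelInd e a w := by
    by_cases hw : e w = a <;> simp [levelInd, hw]
  simp only [Equiv.trans_apply, Equiv.coe_mulLeft, Equiv.coe_mulRight, levelCoef, h]

/-- The translate of an exponent. -/
noncomputable def shiftExp [Group G] (h : G) : (G →₀ ℤ) ≃ (G →₀ ℤ) :=
  (Finsupp.domCongr (Equiv.mulLeft h) : (G →₀ ℤ) ≃+ (G →₀ ℤ)).toEquiv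

theorem shiftExp_apply [Group G] (h : G) (T : G →₀ ℤ) :
    shiftExp h T = Finsupp.equivMapDomain (Equiv.mulLeft h) T := rfl

theorem torusChar_shiftExp [Group G] (h : G) (T : G →₀ ℤ) (w : G → UnitAddCircle) :
    torusChar (shiftExp h T) (h • w) = torusChar T w := by
  rw [torusChar_apply, torusChar_apply, shiftExp_apply, Finsupp.sum_equivMapDomain]
  simp [bernoulli_smul_apply]

variable [MeasurableSpace H] [DiscreteMeasurableSpace H]

theorem fourierMass_zero {e : (G → UnitAddCircle) → H} (he : Measurable e) :
    fourierMass e 0 = ∑' a, bern G circleMeasure {w | e w = a} ^ 2 := by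
  unfold fourierMass levelCoef
  refine tsum_congr fun a => ?_
  congr 1
  have hme : MeasurableSet {w | e w = a} := he (MeasurableSet.of_discrete (s := {a}))
  have h (w : G → UnitAddCircle) : levelInd e a w * conj (torusChar (0 : G →₀ ℤ) w) =
      Set.indicator {w | e w = a} (fun _ => (1 : ℂ)) w := by
    classical
    by_cases h : e w = a <;> simp [levelInd, torusChar_zero, h]
  simp only [h]
  rw [integral_indicator_const _ hme, enorm_smul]
  simp [Measure.real]

variable [Countable G] [Countable H]

theorem tsum_fourierMass {e : (G → UnitAddCircle) → H} (he : Measurable e) :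
    ∑' T, fourierMass e T = 1 := by
  unfold fourierMass levelCoef
  rw [ENNReal.tsum_comm]
  have h (a : H) := tsum_enorm_integral_torusChar_sq (u := levelInd e a)
    (MemLp.of_bound (measurable_levelInd he a).aestronglyMeasurable 1
      (.of_forall fun w => norm_levelInd_le e a w))
  simp only [h, enorm_levelInd_sq]
  have hme (a : H) : MeasurableSet {w | e w = a} := he (MeasurableSet.of_discrete (s := {a}))
  simp only [lintegral_indicator_one (hme _)]
  rw [← measure_iUnion (fun a b hab => Set.disjoint_left.mpr fun w h1 h2 => hab (h1.symm.trans h2)) hme]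
  have : (⋃ a, {w | e w = a}) = Set.univ := by
    ext w
    simp
  rw [this, measure_univ]

theorem tsum_enorm_levelCoef_sub_sq {e e' : (G → UnitAddCircle) → H} (he : Measurable e)
    (he' : Measurable e') :
    ∑' (T : G →₀ ℤ) (a : H), ‖levelCoef e a T - levelCoef e' a T‖ₑ ^ 2 ≤
      2 * bern G circleMeasure {w | e w ≠ e' w} := by
  classical
  rw [ENNReal.tsum_comm]
  have hint (f : (G → UnitAddCircle) → H) (hf : Measurable f) (a : H) (T : G →₀ ℤ) :
      Integrable (fun w => levelInd f a w * conj (torusChar T w)) (bern G circleMeasure) :=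
    Integrable.of_bound ((measurable_levelInd hf a).mul (Complex.continuous_conj.measurable.comp
      (torusChar T).continuous.measurable)).aestronglyMeasurable 1 (.of_forall fun w => by
        rw [norm_mul, RCLike.norm_conj, norm_torusChar, mul_one]
        exact norm_levelInd_le f a w)
  have hsub (a : H) (T : G →₀ ℤ) : levelCoef e a T - levelCoef e' a T =
      ∫ w, (levelInd e a w - levelInd e' a w) * conj (torusChar T w) ∂bern G circleMeasure := by
    unfold levelCoef
    rw [← integral_sub (hint e he a T) (hint e' he' a T)]
    simp only [sub_mul]
  have h (a : H) := tsum_enorm_integral_torusChar_sq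
    (u := fun w => levelInd e a w - levelInd e' a w)
    (MemLp.of_bound ((measurable_levelInd he a).sub
      (measurable_levelInd he' a)).aestronglyMeasurable 2 (.of_forall fun w =>
        (norm_sub_le _ _).trans (by linarith [norm_levelInd_le e a w, norm_levelInd_le e' a w])))
  simp only [hsub, h]
  have hme : MeasurableSet {w | e w ≠ e' w} := (measurableSet_eq_fun_discrete he he').compl
  rw [← lintegral_tsum (f := fun a w => ‖levelInd e a w - levelInd e' a w‖ₑ ^ 2)
    fun a => (((measurable_levelInd he a).sub
      (measurable_levelInd he' a)).enorm.pow_const 2).aemeasurable,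
    ← lintegral_indicator_one hme, ← lintegral_const_mul _ (measurable_one.indicator hme)]
  refine lintegral_mono fun w => ?_
  by_cases hw : e w = e' w
  · simp [levelInd, hw]
  · have hle (a : H) : ‖levelInd e a w - levelInd e' a w‖ₑ ^ 2 ≤
        (if a = e w then 1 else 0) + (if a = e' w then 1 else 0) := by
      by_cases h1 : e w = a
      · subst h1
        simp [levelInd, hw, Ne.symm hw]
      · by_cases h2 : e' w = a <;> simp [levelInd, h1, h2, eq_comm]
    refine (ENNReal.tsum_le_tsum hle).trans ?_
    rw [ENNReal.tsum_add, tsum_ite_eq, tsum_ite_eq]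
    simp [hw, one_add_one_eq_two]

theorem enorm_sq_le_of_sub (x y : ℂ) {δ : NNReal} (hδ : δ ≠ 0) :
    ‖x‖ₑ ^ 2 ≤ (1 + δ) * ‖y‖ₑ ^ 2 + (1 + (δ⁻¹ : NNReal)) * ‖x - y‖ₑ ^ 2 := by
  simp only [enorm_eq_nnnorm]
  norm_cast
  have h1 : ‖x‖ ≤ ‖y‖ + ‖x - y‖ := by simpa using norm_add_le y (x - y)
  rw [← NNReal.coe_le_coe]
  push_cast
  have hδ' : (0 : ℝ) < δ := by positivity
  have h2 : ‖x‖ ^ 2 ≤ (‖y‖ + ‖x - y‖) ^ 2 := by gcongr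
  have h3 : (1 + (δ : ℝ)) * ‖y‖ ^ 2 + (1 + (δ : ℝ)⁻¹) * ‖x - y‖ ^ 2 - (‖y‖ + ‖x - y‖) ^ 2 =
      (δ : ℝ)⁻¹ * (δ * ‖y‖ - ‖x - y‖) ^ 2 := by
    field_simp
    ring
  have : 0 ≤ (δ : ℝ)⁻¹ * (δ * ‖y‖ - ‖x - y‖) ^ 2 := by positivity
  linarith

theorem tsum_fourierMass_mul_le {e e' : (G → UnitAddCircle) → H} (he : Measurable e)
    (he' : Measurable e') {ψ : (G →₀ ℤ) → ℝ≥0∞} (hψ : ∀ T, ψ T ≤ 1) {δ : NNReal} (hδ : δ ≠ 0) :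
    ∑' T, fourierMass e T * ψ T ≤ ∑' T, fourierMass e' T * ψ T +
      (δ + (1 + (δ⁻¹ : NNReal)) * (2 * bern G circleMeasure {w | e w ≠ e' w})) := by
  have h1 (T : G →₀ ℤ) : fourierMass e T * ψ T ≤ fourierMass e' T * ψ T + (δ * fourierMass e' T +
      (1 + (δ⁻¹ : NNReal)) * ∑' a, ‖levelCoef e a T - levelCoef e' a T‖ₑ ^ 2) := by
    have h2 : fourierMass e T ≤ (1 + δ) * fourierMass e' T +
        (1 + (δ⁻¹ : NNReal)) * ∑' a, ‖levelCoef e a T - levelCoef e' a T‖ₑ ^ 2 := by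
      unfold fourierMass
      rw [← ENNReal.tsum_mul_left, ← ENNReal.tsum_mul_left, ← ENNReal.tsum_add]
      exact ENNReal.tsum_le_tsum fun a => enorm_sq_le_of_sub _ _ hδ
    calc fourierMass e T * ψ T ≤ ((1 + δ) * fourierMass e' T +
        (1 + (δ⁻¹ : NNReal)) * ∑' a, ‖levelCoef e a T - levelCoef e' a T‖ₑ ^ 2) * ψ T := by gcongr
      _ = fourierMass e' T * ψ T + (δ * fourierMass e' T +
        (1 + (δ⁻¹ : NNReal)) * ∑' a, ‖levelCoef e a T - levelCoef e' a T‖ₑ ^ 2) * ψ T := by ring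
      _ ≤ _ := by
        gcongr
        exact mul_le_of_le_one_right' (hψ T)
  refine (ENNReal.tsum_le_tsum h1).trans ?_
  rw [ENNReal.tsum_add, ENNReal.tsum_add, ENNReal.tsum_mul_left, ENNReal.tsum_mul_left,
    tsum_fourierMass he', mul_one]
  gcongr
  exact tsum_enorm_levelCoef_sub_sq he he'

theorem fourierMass_smul [Group G] {H : Type} [MeasurableSpace H] [DiscreteMeasurableSpace H]
    {e : (G → UnitAddCircle) → H} (he : Measurable e) (h : G) (T : G →₀ ℤ) :
    fourierMass (fun w => e (h • w)) T = fourierMass e (shiftExp h T) := by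
  unfold fourierMass
  refine tsum_congr fun a => ?_
  congr 2
  unfold levelCoef
  have hm := measurePreserving_smul_bern (G := G) (β := circleMeasure) h
  conv_rhs => rw [← hm.map_eq]
  rw [integral_map hm.aemeasurable]
  · simp only [torusChar_shiftExp]
    rfl
  · exact ((measurable_levelInd he a).mul
      (Complex.continuous_conj.measurable.comp (torusChar _).continuous.measurable)).aestronglyMeasurable

end FourierMass

section TotalMass

theorem measurable_fourierMass {G X H : Type} [MeasurableSpace X] [Countable G] [Countable H]
    [MeasurableSpace H] [DiscreteMeasurableSpace H] {η : X → (G → UnitAddCircle) → H}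
    (hη : Measurable (Function.uncurry η)) (T : G →₀ ℤ) :
    Measurable fun x => fourierMass (η x) T := by
  unfold fourierMass levelCoef
  refine Measurable.tsum fun a => Measurable.pow_const (Measurable.enorm ?_) 2
  refine StronglyMeasurable.measurable ?_
  refine StronglyMeasurable.integral_prod_right
    (f := fun x w => levelInd (η x) a w * (starRingEnd ℂ) (torusChar T w)) ?_
  refine Measurable.stronglyMeasurable (Measurable.mul ?_ ?_)
  · exact measurable_levelInd hη a
  · exact (Complex.continuous_conj.measurable.comp (torusChar T).continuous.measurable).comp
      measurable_snd

variable {G : Type} [Group G]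

/-- A left-`C`-equivariant retraction of `G` onto the subgroup `C`. -/
noncomputable def cosetRetract (C : Subgroup G) (g : G) : C :=
  ⟨g * (QuotientGroup.mk g⁻¹ : G ⧸ C).out, by
    obtain ⟨k, hk⟩ := QuotientGroup.mk_out_eq_mul C g⁻¹
    rw [hk, mul_inv_cancel_left]
    exact k.2⟩

theorem cosetRetract_mul (C : Subgroup G) (h : C) (g : G) :
    cosetRetract C (h * g) = h * cosetRetract C g := by
  have : (QuotientGroup.mk ((h : G) * g)⁻¹ : G ⧸ C) = QuotientGroup.mk g⁻¹ := by
    rw [mul_inv_rev]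
    exact QuotientGroup.mk_mul_of_mem _ (C.inv_mem h.2)
  apply Subtype.ext
  simp only [cosetRetract, this, Subgroup.coe_mul, mul_assoc]

/-- The proportion of the support of `T` that retracts into `E`. -/
noncomputable def supportWeight (C : Subgroup G) (E : Set C) (T : G →₀ ℤ) : ℝ≥0∞ :=
  (∑ g ∈ T.support, E.indicator 1 (cosetRetract C g)) / T.support.card

theorem supportWeight_le_one (C : Subgroup G) (E : Set C) (T : G →₀ ℤ) :
    supportWeight C E T ≤ 1 := by
  refine ENNReal.div_le_of_le_mul ?_
  rw [one_mul]
  refine (Finset.sum_le_card_nsmul _ _ 1 fun g _ => ?_).trans_eq (by simp)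
  exact Set.indicator_le_self' (fun _ _ => zero_le) _

theorem supportWeight_union (C : Subgroup G) {E F : Set C} (h : Disjoint E F) (T : G →₀ ℤ) :
    supportWeight C (E ∪ F) T = supportWeight C E T + supportWeight C F T := by
  simp only [supportWeight, Set.indicator_union_of_disjoint h, Finset.sum_add_distrib,
    ENNReal.add_div]

theorem supportWeight_zero (C : Subgroup G) (E : Set C) : supportWeight C E 0 = 0 := by
  simp [supportWeight]

theorem supportWeight_univ (C : Subgroup G) {T : G →₀ ℤ} (hT : T ≠ 0) :
    supportWeight C Set.univ T = 1 := by
  simp only [supportWeight, Set.indicator_univ, Pi.one_apply, Finset.sum_const, nsmul_eq_mul,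
    mul_one]
  exact ENNReal.div_self (by simpa using hT) (by simp)

theorem supportWeight_shiftExp (C : Subgroup G) (h : C) (E : Set C) (T : G →₀ ℤ) :
    supportWeight C ((h * ·) '' E) (shiftExp (h : G) T) = supportWeight C E T := by
  classical
  have hs : (shiftExp (h : G) T).support = T.support.map (Equiv.mulLeft (h : G)).toEmbedding := rfl
  have hi (k : C) : ((h * ·) '' E).indicator (1 : C → ℝ≥0∞) (h * k) = E.indicator 1 k := by
    by_cases hk : k ∈ E <;> simp [Set.indicator, hk]
  simp only [supportWeight, hs, Finset.sum_map, Finset.card_map, Equiv.coe_toEmbedding,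
    Equiv.coe_mulLeft, cosetRetract_mul, hi]

/-- The Fourier mass of a random `H`-valued map on the torus, distributed over the subsets of the
subgroup `C`. -/
noncomputable def totalMass {X H : Type} [MeasurableSpace X] (P : Measure X) (C : Subgroup G)
    (η : X → (G → UnitAddCircle) → H) (E : Set C) : ℝ≥0∞ :=
  ∫⁻ x, ∑' T, fourierMass (η x) T * supportWeight C E T ∂P

variable {X H : Type} [MeasurableSpace X] {P : Measure X}

theorem totalMass_mul_mul [Group H] (C : Subgroup G) (η : X → (G → UnitAddCircle) → H)
    (α β : X → H) (E : Set C) :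
    totalMass P C (fun x w => α x * η x w * β x) E = totalMass P C η E := by
  simp only [totalMass, fourierMass_mul_mul]

variable [Countable G] [Countable H] [MeasurableSpace H] [DiscreteMeasurableSpace H]

theorem measurable_totalMass_integrand (C : Subgroup G) {η : X → (G → UnitAddCircle) → H}
    (hη : Measurable (Function.uncurry η)) (E : Set C) :
    Measurable fun x => ∑' T, fourierMass (η x) T * supportWeight C E T :=
  Measurable.tsum fun T => (measurable_fourierMass hη T).mul_const _

theorem totalMass_union (C : Subgroup G) {η : X → (G → UnitAddCircle) → H}
    (hη : Measurable (Function.uncurry η)) {E F : Set C} (h : Disjoint E F) :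
    totalMass P C η (E ∪ F) = totalMass P C η E + totalMass P C η F := by
  unfold totalMass
  rw [← lintegral_add_left (measurable_totalMass_integrand C hη E)]
  simp only [supportWeight_union C h, mul_add, ENNReal.tsum_add]

theorem totalMass_univ [IsProbabilityMeasure P] (C : Subgroup G)
    {η : X → (G → UnitAddCircle) → H} (hη : Measurable (Function.uncurry η)) :
    totalMass P C η Set.univ = (P.prod ((bern G circleMeasure).prod (bern G circleMeasure)))
      {p | η p.1 p.2.1 ≠ η p.1 p.2.2} := by
  classical
  have hη1 (x : X) : Measurable (η x) := hη.comp measurable_prodMk_left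
  have hm : MeasurableSet {p : X × (G → UnitAddCircle) × (G → UnitAddCircle) |
      η p.1 p.2.1 = η p.1 p.2.2} :=
    measurableSet_eq_fun_discrete
      (hη.comp (measurable_fst.prodMk (measurable_fst.comp measurable_snd)))
      (hη.comp (measurable_fst.prodMk (measurable_snd.comp measurable_snd)))
  have h1 : (P.prod ((bern G circleMeasure).prod (bern G circleMeasure)))
      {p | η p.1 p.2.1 = η p.1 p.2.2} = ∫⁻ x, fourierMass (η x) 0 ∂P := by
    rw [Measure.prod_apply hm]
    refine lintegral_congr fun x => ?_
    have hme (a : H) : MeasurableSet {w | η x w = a} :=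
      hη1 x (MeasurableSet.of_discrete (s := {a}))
    have : (Prod.mk x ⁻¹' {p : X × (G → UnitAddCircle) × (G → UnitAddCircle) |
        η p.1 p.2.1 = η p.1 p.2.2}) = ⋃ a, {w | η x w = a} ×ˢ {w | η x w = a} := by
      ext w
      simp [eq_comm]
    rw [fourierMass_zero (hη1 x), this, measure_iUnion]
    · simp only [Measure.prod_prod, sq]
    · intro a b hab
      exact Set.disjoint_left.mpr fun w h1 h2 => hab (h1.1.symm.trans h2.1)
    · exact fun a => (hme a).prod (hme a)
  have h2 : totalMass P C η Set.univ + ∫⁻ x, fourierMass (η x) 0 ∂P = 1 := by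
    unfold totalMass
    rw [← lintegral_add_right _ (measurable_fourierMass hη 0)]
    have (x : X) : ∑' T, fourierMass (η x) T * supportWeight C Set.univ T + fourierMass (η x) 0 =
        1 := by
      rw [← tsum_fourierMass (hη1 x), ← tsum_ite_eq (0 : G →₀ ℤ) fun T => fourierMass (η x) T,
        ← ENNReal.tsum_add]
      refine tsum_congr fun T => ?_
      by_cases hT : T = 0
      · simp [hT, supportWeight_zero]
      · simp [hT, supportWeight_univ C hT]
    simp [this]
  have h3 := prob_add_prob_compl (μ := P.prod ((bern G circleMeasure).prod (bern G circleMeasure)))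
    hm
  rw [add_comm, h1, ← h2] at h3
  exact (ENNReal.add_left_inj (ne_top_of_le_ne_top ENNReal.one_ne_top
    (le_of_le_of_eq le_add_self h2))).mp h3.symm

theorem totalMass_le [IsProbabilityMeasure P] (C : Subgroup G)
    {η η' : X → (G → UnitAddCircle) → H} (hη : Measurable (Function.uncurry η))
    (hη' : Measurable (Function.uncurry η')) (E : Set C) {δ : NNReal} (hδ : δ ≠ 0) :
    totalMass P C η E ≤ totalMass P C η' E + (δ + (1 + (δ⁻¹ : NNReal)) *
      (2 * (P.prod (bern G circleMeasure)) {p | η p.1 p.2 ≠ η' p.1 p.2})) := by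
  have hm : MeasurableSet {p : X × (G → UnitAddCircle) | η p.1 p.2 ≠ η' p.1 p.2} :=
    (measurableSet_eq_fun_discrete hη hη').compl
  have hmm : Measurable fun x => bern G circleMeasure {w | η x w ≠ η' x w} :=
    measurable_measure_prodMk_left hm
  refine (lintegral_mono fun x => tsum_fourierMass_mul_le (e := η x) (e' := η' x)
    (hη.comp measurable_prodMk_left) (hη'.comp measurable_prodMk_left)
    (supportWeight_le_one C E) hδ).trans_eq ?_
  rw [lintegral_add_left (measurable_totalMass_integrand C hη' E),
    lintegral_add_left measurable_const, lintegral_const, measure_univ, mul_one,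
    lintegral_const_mul _ (hmm.const_mul 2), lintegral_const_mul _ hmm, Measure.prod_apply hm]
  rfl

theorem totalMass_smul {A : Type} [MeasurableSpace A] {β : Measure A} [IsProbabilityMeasure β]
    (C : Subgroup G) {η : (G → A) → (G → UnitAddCircle) → H}
    (hη : Measurable (Function.uncurry η)) (h : C) (E : Set C) :
    totalMass (bern G β) C (fun x w => η ((h : G) • x) ((h : G) • w)) E =
      totalMass (bern G β) C η ((h * ·) '' E) := by
  unfold totalMass
  rw [← (measurePreserving_smul_bern (G := G) (β := β) (h : G)).lintegral_comp
    (measurable_totalMass_integrand C hη _)]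
  refine lintegral_congr fun x => ?_
  conv_rhs => rw [← (shiftExp (h : G)).tsum_eq]
  refine tsum_congr fun T => ?_
  rw [supportWeight_shiftExp, fourierMass_smul (e := η ((h : G) • x)) (hη.comp measurable_prodMk_left)]

end TotalMass

section Amenability

open Filter Topology

theorem isAmenable_of_asymptotically_invariant {C : Type} [Group C] {m : ℕ → Set C → ℝ}
    (hnonneg : ∀ n E, 0 ≤ m n E) (huniv : ∀ n, m n Set.univ = 1)
    (hadd : ∀ n E F, Disjoint E F → m n (E ∪ F) = m n E + m n F)
    (hinv : ∀ (h : C) (E : Set C), ∀ ε > 0, ∀ᶠ n in atTop, m n ((h * ·) '' E) ≤ m n E + ε) :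
    IsAmenable C := by
  have hle (n : ℕ) (E : Set C) : m n E ≤ 1 := by
    rw [← huniv n, ← Set.union_compl_self E, hadd n E Eᶜ disjoint_compl_right]
    linarith [hnonneg n Eᶜ]
  have hlim (E : Set C) : ∃ L, Tendsto (fun n => m n E) (hyperfilter ℕ : Filter ℕ) (𝓝 L) := by
    obtain ⟨L, -, hL⟩ := isCompact_Icc.ultrafilter_le_nhds
      ((hyperfilter ℕ).map fun n => m n E) (s := Set.Icc 0 1)
      (le_principal_iff.mpr (mem_map.mpr (Eventually.of_forall fun n => ⟨hnonneg n E, hle n E⟩)))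
    exact ⟨L, hL⟩
  choose L hL using hlim
  have hU : (hyperfilter ℕ : Filter ℕ) ≤ atTop := Nat.hyperfilter_le_atTop
  have hLinv (h : C) (E : Set C) : L ((h * ·) '' E) ≤ L E := by
    refine le_of_forall_pos_le_add fun ε hε => ?_
    exact le_of_tendsto_of_tendsto (hL _) ((hL E).add_const ε) (hU (hinv h E ε hε))
  refine ⟨L, ?_, fun E => ge_of_tendsto' (hL E) fun n => hnonneg n E, fun E F hEF => ?_,
    fun h E => le_antisymm (hLinv h E) ?_⟩
  · refine tendsto_nhds_unique (hL _) ?_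
    simp only [huniv]
    exact tendsto_const_nhds
  · refine tendsto_nhds_unique (hL _) ?_
    simp only [hadd _ E F hEF]
    exact (hL E).add (hL F)
  · have := hLinv h⁻¹ ((h * ·) '' E)
    rwa [Set.image_image, show (fun x => h⁻¹ * (h * x)) = id by ext; simp, Set.image_id] at this

end Amenability

section PairLaw

open Filter Topology
open scoped NNReal

variable {A : Type} [MeasurableSpace A]

/-- The law of a pair which is equal with weight `p` and independent with weight `q`. -/
noncomputable def pairLaw (μ₀ : Measure A) (p q : ℝ≥0) : Measure (A × A) :=
  p • μ₀.map (fun a => (a, a)) + q • μ₀.prod μ₀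

variable {μ₀ : Measure A} [IsProbabilityMeasure μ₀]

theorem pairLaw_prod (p q : ℝ≥0) {s t : Set A} (hs : MeasurableSet s) (ht : MeasurableSet t) :
    pairLaw μ₀ p q (s ×ˢ t) = p * μ₀ (s ∩ t) + q * (μ₀ s * μ₀ t) := by
  simp only [pairLaw, Measure.add_apply, Measure.smul_apply, Measure.prod_prod]
  rw [Measure.map_apply (by fun_prop) (hs.prod ht)]
  rfl

theorem isProbabilityMeasure_pairLaw {p q : ℝ≥0} (h : p + q = 1) :
    IsProbabilityMeasure (pairLaw μ₀ p q) := by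
  refine ⟨?_⟩
  rw [← Set.univ_prod_univ, pairLaw_prod p q .univ .univ]
  simp only [Set.inter_univ, measure_univ, mul_one]
  exact_mod_cast h

theorem measurePreserving_fst_pairLaw {p q : ℝ≥0} (h : p + q = 1) :
    MeasurePreserving Prod.fst (pairLaw μ₀ p q) μ₀ := by
  refine ⟨measurable_fst, Measure.ext fun s hs => ?_⟩
  rw [Measure.map_apply measurable_fst hs, ← Set.prod_univ, pairLaw_prod p q hs .univ,
    Set.inter_univ, measure_univ, mul_one, ← add_mul, ← ENNReal.coe_add, h, ENNReal.coe_one, one_mul]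

theorem measurePreserving_snd_pairLaw {p q : ℝ≥0} (h : p + q = 1) :
    MeasurePreserving Prod.snd (pairLaw μ₀ p q) μ₀ := by
  refine ⟨measurable_snd, Measure.ext fun s hs => ?_⟩
  rw [Measure.map_apply measurable_snd hs, ← Set.univ_prod, pairLaw_prod p q .univ hs,
    Set.univ_inter, measure_univ, one_mul, ← add_mul, ← ENNReal.coe_add, h, ENNReal.coe_one, one_mul]

theorem eq_pairLaw {ρ : Measure (A × A)} {p q : ℝ≥0} (hpq : p + q = 1)
    (h : ∀ s t, MeasurableSet s → MeasurableSet t →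
      ρ (s ×ˢ t) = p * μ₀ (s ∩ t) + q * (μ₀ s * μ₀ t)) : ρ = pairLaw μ₀ p q := by
  have := isProbabilityMeasure_pairLaw (μ₀ := μ₀) hpq
  have hρ : IsProbabilityMeasure ρ := by
    refine ⟨?_⟩
    rw [← Set.univ_prod_univ, h _ _ .univ .univ, ← pairLaw_prod p q .univ .univ,
      Set.univ_prod_univ, measure_univ]
  exact Measure.ext_prod fun hs ht => by rw [h _ _ hs ht, pairLaw_prod p q hs ht]

section Continuity

variable {G : Type} {p q : ℕ → ℝ≥0}

theorem tendsto_bern_pairLaw_diff (hpq : ∀ n, p n + q n = 1) (hq : Tendsto q atTop (𝓝 0))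
    {E : Set (G → A)} (hE : MeasurableSet E) :
    Tendsto (fun n => bern G (pairLaw μ₀ (p n) (q n))
      {z | (fun g => (z g).1) ∈ E ∧ (fun g => (z g).2) ∉ E}) atTop (𝓝 0) := by
  have hprob (n : ℕ) := isProbabilityMeasure_pairLaw (μ₀ := μ₀) (hpq n)
  have hfst (n : ℕ) : MeasurePreserving (fun (z : G → A × A) g => (z g).1)
      (bern G (pairLaw μ₀ (p n) (q n))) (bern G μ₀) :=
    measurePreserving_bern_map (measurePreserving_fst_pairLaw (hpq n))
  have hsnd (n : ℕ) : MeasurePreserving (fun (z : G → A × A) g => (z g).2)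
      (bern G (pairLaw μ₀ (p n) (q n))) (bern G μ₀) :=
    measurePreserving_bern_map (measurePreserving_snd_pairLaw (hpq n))
  induction E, hE using MeasurableSpace.induction_on_inter
    (generateFrom_squareCylinders (α := fun _ : G => A)).symm isPiSystem_pi_finset with
  | empty => simp
  | basic E hE =>
    obtain ⟨F, t, ht, rfl⟩ := hE
    have ht' : ∀ g, MeasurableSet (t g) := fun g => ht g trivial
    have hle (n : ℕ) : bern G (pairLaw μ₀ (p n) (q n)) {z | (fun g => (z g).1) ∈ (F : Set G).pi t ∧
        (fun g => (z g).2) ∉ (F : Set G).pi t} ≤ F.card * q n := by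
      have hsub : {z : G → A × A | (fun g => (z g).1) ∈ (F : Set G).pi t ∧
          (fun g => (z g).2) ∉ (F : Set G).pi t} ⊆ ⋃ g ∈ F, Function.eval g ⁻¹' (t g ×ˢ (t g)ᶜ) := by
        rintro z ⟨h1, h2⟩
        simp only [Set.mem_pi, not_forall] at h2
        obtain ⟨g, hg, h2⟩ := h2
        exact Set.mem_biUnion hg ⟨h1 g hg, h2⟩
      refine (measure_mono hsub).trans ((measure_biUnion_finset_le F _).trans ?_)
      rw [← nsmul_eq_mul]
      refine Finset.sum_le_card_nsmul _ _ _ fun g _ => ?_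
      rw [(measurePreserving_eval_infinitePi (fun _ : G => pairLaw μ₀ (p n) (q n)) g).measure_preimage
        ((ht' g).prod (ht' g).compl).nullMeasurableSet, pairLaw_prod _ _ (ht' g) (ht' g).compl]
      simp only [Set.inter_compl_self, measure_empty, mul_zero, zero_add]
      exact mul_le_of_le_one_right' (mul_le_one' prob_le_one prob_le_one)
    refine tendsto_of_tendsto_of_tendsto_of_le_of_le tendsto_const_nhds ?_
      (fun _ => zero_le) hle
    have := ENNReal.Tendsto.const_mul (a := (F.card : ℝ≥0∞)) (ENNReal.tendsto_coe.mpr hq)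
      (Or.inr (by simp))
    simpa using this
  | compl E hE ih =>
    refine ih.congr fun n => ?_
    have h1 := measure_inter_add_sdiff (μ := bern G (pairLaw μ₀ (p n) (q n)))
      ((fun (z : G → A × A) g => (z g).1) ⁻¹' E) ((hsnd n).measurable hE)
    have h2 := measure_inter_add_sdiff (μ := bern G (pairLaw μ₀ (p n) (q n)))
      ((fun (z : G → A × A) g => (z g).2) ⁻¹' E) ((hfst n).measurable hE)
    rw [(hfst n).measure_preimage hE.nullMeasurableSet] at h1
    rw [(hsnd n).measure_preimage hE.nullMeasurableSet, Set.inter_comm, ← h1] at h2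
    have h3 := (ENNReal.add_right_inj (measure_ne_top _ _)).mp h2
    refine h3.symm.trans (congrArg _ ?_)
    ext z
    simp [and_comm]
  | iUnion f hd hf ih =>
    have hle (n : ℕ) : bern G (pairLaw μ₀ (p n) (q n))
        {z | (fun g => (z g).1) ∈ ⋃ i, f i ∧ (fun g => (z g).2) ∉ ⋃ i, f i} ≤
        ∑' i, bern G (pairLaw μ₀ (p n) (q n))
          {z | (fun g => (z g).1) ∈ f i ∧ (fun g => (z g).2) ∉ f i} := by
      refine (measure_mono ?_).trans (measure_iUnion_le _)
      rintro z ⟨h1, h2⟩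
      obtain ⟨i, hi⟩ := Set.mem_iUnion.mp h1
      exact Set.mem_iUnion.mpr ⟨i, hi, fun h => h2 (Set.mem_iUnion.mpr ⟨i, h⟩)⟩
    refine tendsto_of_tendsto_of_tendsto_of_le_of_le tendsto_const_nhds ?_
      (fun _ => zero_le) hle
    have := tendsto_tsum_ennreal_of_dominated (bound := fun i => bern G μ₀ (f i))
      (by rw [← measure_iUnion hd hf]; exact measure_ne_top _ _)
      (fun n i => (measure_mono fun z hz => hz.1).trans_eq
        ((hfst n).measure_preimage (hf i).nullMeasurableSet)) ih
    simpa using this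

/-- A measurable discrete-valued function is asymptotically unaffected by resampling each
coordinate with vanishing probability. -/
theorem tendsto_bern_pairLaw_ne (hpq : ∀ n, p n + q n = 1) (hq : Tendsto q atTop (𝓝 0))
    {H : Type} [Countable H] [MeasurableSpace H] [DiscreteMeasurableSpace H]
    {f : (G → A) → H} (hf : Measurable f) :
    Tendsto (fun n => bern G (pairLaw μ₀ (p n) (q n))
      {z | f (fun g => (z g).1) ≠ f (fun g => (z g).2)}) atTop (𝓝 0) := by
  have hprob (n : ℕ) := isProbabilityMeasure_pairLaw (μ₀ := μ₀) (hpq n)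
  have hfst (n : ℕ) : MeasurePreserving (fun (z : G → A × A) g => (z g).1)
      (bern G (pairLaw μ₀ (p n) (q n))) (bern G μ₀) :=
    measurePreserving_bern_map (measurePreserving_fst_pairLaw (hpq n))
  have hE (a : H) : MeasurableSet (f ⁻¹' {a}) := hf .of_discrete
  have hle (n : ℕ) : bern G (pairLaw μ₀ (p n) (q n))
      {z | f (fun g => (z g).1) ≠ f (fun g => (z g).2)} ≤
      ∑' a, bern G (pairLaw μ₀ (p n) (q n))
        {z | (fun g => (z g).1) ∈ f ⁻¹' {a} ∧ (fun g => (z g).2) ∉ f ⁻¹' {a}} := by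
    refine (measure_mono ?_).trans (measure_iUnion_le _)
    intro z hz
    exact Set.mem_iUnion.mpr ⟨f fun g => (z g).1, rfl, fun h => hz h.symm⟩
  refine tendsto_of_tendsto_of_tendsto_of_le_of_le tendsto_const_nhds ?_
    (fun _ => zero_le) hle
  have hsum : ∑' a, bern G μ₀ (f ⁻¹' {a}) ≠ ∞ := by
    rw [← measure_iUnion (f := fun a => f ⁻¹' {a}) (fun a b hab => Set.disjoint_left.mpr
      fun x h1 h2 => hab (Eq.trans (Eq.symm h1) h2)) hE]
    exact measure_ne_top _ _
  have := tendsto_tsum_ennreal_of_dominated hsum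
    (fun n a => (measure_mono fun z hz => hz.1).trans_eq
      ((hfst n).measure_preimage (hE a).nullMeasurableSet))
    fun a => tendsto_bern_pairLaw_diff (μ₀ := μ₀) hpq hq (hE a)
  simpa using this

end Continuity

end PairLaw

section Resampling

open scoped NNReal unitInterval
open Set (Ioc Icc)

theorem exists_measurePreserving_circle_unitInterval :
    ∃ ι : UnitAddCircle → I, MeasurePreserving ι circleMeasure volume := by
  have hvol : (volume : Measure UnitAddCircle) = circleMeasure := by
    have := AddCircle.volume_eq_smul_haarAddCircle (T := 1)
    simpa using this
  have hι := AddCircle.measurePreserving_equivIoc (T := 1) (a := 0)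
  rw [hvol] at hι
  let ι : UnitAddCircle → I := fun u => ⟨AddCircle.equivIoc 1 0 u,
    (AddCircle.equivIoc 1 0 u).2.1.le, by simpa using (AddCircle.equivIoc 1 0 u).2.2⟩
  have hval : Measurable fun u : UnitAddCircle => (AddCircle.equivIoc 1 0 u : ℝ) :=
    measurable_subtype_coe.comp hι.measurable
  have hm : Measurable ι := hval.subtype_mk
  refine ⟨ι, hm, ?_⟩
  have h1 : circleMeasure.map (fun u : UnitAddCircle => (AddCircle.equivIoc 1 0 u : ℝ)) =
      volume.restrict (Icc (0 : ℝ) 1) := by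
    refine (Measure.map_map measurable_subtype_coe hι.measurable).symm.trans ?_
    rw [hι.map_eq, map_comap_subtype_coe measurableSet_Ioc, zero_add, restrict_Ioc_eq_restrict_Icc]
  refine Measure.ext fun s hs => ?_
  have hs' : MeasurableSet (Subtype.val '' s : Set ℝ) := measurableSet_Icc.subtype_image hs
  have h2 := congrArg (fun m : Measure ℝ => m (Subtype.val '' s)) h1
  simp only [Measure.map_apply hval hs', Measure.restrict_apply hs'] at h2
  rw [Measure.map_apply hm hs, unitInterval.volume_apply]
  convert h2 using 2
  · ext u
    simp only [Set.mem_preimage, Set.mem_image]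
    exact ⟨fun h => ⟨_, h, rfl⟩, fun ⟨x, hx, hxu⟩ => by rwa [show ι u = x from Subtype.ext hxu.symm]⟩
  · rw [Set.inter_eq_left.mpr]
    rintro _ ⟨x, -, rfl⟩
    exact x.2

variable {A : Type} [MeasurableSpace A] {μ₀ : Measure A} [IsProbabilityMeasure μ₀]

/-- The kernel that keeps a point with weight `p` and resamples it with weight `q`. -/
noncomputable def resampleKernel (μ₀ : Measure A) (p q : ℝ≥0) : ProbabilityTheory.Kernel A A where
  toFun a := p • Measure.dirac a + q • μ₀
  measurable' := by
    refine Measure.measurable_of_measurable_coe _ fun s hs => ?_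
    simp only [Measure.add_apply, Measure.smul_apply]
    refine Measurable.add ?_ measurable_const
    exact ((Measure.measurable_coe hs).comp Measure.measurable_dirac).const_smul p

theorem exists_resample [StandardBorelSpace A] (μ₀ : Measure A) [IsProbabilityMeasure μ₀]
    {p q : ℝ≥0} (hpq : p + q = 1) :
    ∃ F : A × UnitAddCircle → A, Measurable F ∧ ∀ a s, MeasurableSet s →
      circleMeasure {u | F (a, u) ∈ s} = p * s.indicator 1 a + q * μ₀ s := by
  have : Nonempty A := nonempty_of_isProbabilityMeasure μ₀
  have : ProbabilityTheory.IsMarkovKernel (resampleKernel μ₀ p q) := by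
    refine ⟨fun a => ⟨?_⟩⟩
    change (p • Measure.dirac a + q • μ₀) Set.univ = 1
    simp only [Measure.add_apply, Measure.smul_apply, measure_univ]
    simp only [ENNReal.smul_def, smul_eq_mul, mul_one]
    exact_mod_cast hpq
  obtain ⟨f, hf, hfκ⟩ := (resampleKernel μ₀ p q).exists_measurable_map_eq_unitInterval
  obtain ⟨ι, hι⟩ := exists_measurePreserving_circle_unitInterval
  refine ⟨fun x => f x.1 (ι x.2),
    hf.comp (measurable_fst.prodMk (hι.measurable.comp measurable_snd)), fun a s hs => ?_⟩
  have hfa : Measurable (f a) := hf.comp measurable_prodMk_left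
  have h := congrArg (fun m : Measure A => m s) (hfκ a)
  rw [← hι.map_eq, Measure.map_map hfa hι.measurable] at h
  simp only [Measure.map_apply (hfa.comp hι.measurable) hs] at h
  refine h.trans ?_
  change (p • Measure.dirac a + q • μ₀) s = _
  simp only [Measure.add_apply, Measure.smul_apply, Measure.dirac_apply' a hs]
  rfl

variable {p q : ℝ≥0} {F : A × UnitAddCircle → A}

theorem map_resample_left (hpq : p + q = 1) (hF : Measurable F)
    (hFκ : ∀ a s, MeasurableSet s →
      circleMeasure {u | F (a, u) ∈ s} = p * s.indicator 1 a + q * μ₀ s) :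
    MeasurePreserving (fun x : A × UnitAddCircle => (x.1, F x)) (μ₀.prod circleMeasure)
      (pairLaw μ₀ p q) := by
  refine ⟨by fun_prop, eq_pairLaw hpq fun s t hs ht => ?_⟩
  rw [Measure.map_apply (by fun_prop) (hs.prod ht),
    Measure.prod_apply (((measurable_fst.prodMk hF)) (hs.prod ht))]
  have h (a : A) : circleMeasure (Prod.mk a ⁻¹' ((fun x : A × UnitAddCircle => (x.1, F x)) ⁻¹' s ×ˢ t)) =
      p * (s ∩ t).indicator 1 a + q * (s.indicator 1 a * μ₀ t) := by
    by_cases ha : a ∈ s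
    · have : (Prod.mk a ⁻¹' ((fun x : A × UnitAddCircle => (x.1, F x)) ⁻¹' s ×ˢ t)) =
          {u | F (a, u) ∈ t} := by
        ext u
        simp [ha]
      rw [this, hFκ a t ht]
      by_cases hat : a ∈ t <;> simp [ha, hat]
    · have : (Prod.mk a ⁻¹' ((fun x : A × UnitAddCircle => (x.1, F x)) ⁻¹' s ×ˢ t)) = ∅ := by
        ext u
        simp [ha]
      rw [this]
      simp [Set.indicator, ha]
  have hm1 : Measurable ((s ∩ t).indicator (1 : A → ℝ≥0∞)) := measurable_one.indicator (hs.inter ht)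
  have hm2 : Measurable (s.indicator (1 : A → ℝ≥0∞)) := measurable_one.indicator hs
  simp only [h]
  rw [lintegral_add_left (hm1.const_mul _), lintegral_const_mul _ hm1,
    lintegral_const_mul _ (hm2.mul_const _), lintegral_mul_const _ hm2,
    lintegral_indicator_one (hs.inter ht), lintegral_indicator_one hs]

theorem map_resample_both (hpq : p + q = 1) (hF : Measurable F)
    (hFκ : ∀ a s, MeasurableSet s →
      circleMeasure {u | F (a, u) ∈ s} = p * s.indicator 1 a + q * μ₀ s) :
    MeasurePreserving (fun x : A × UnitAddCircle × UnitAddCircle => (F (x.1, x.2.1), F (x.1, x.2.2)))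
      (μ₀.prod (circleMeasure.prod circleMeasure)) (pairLaw μ₀ (p ^ 2) (2 * p * q + q ^ 2)) := by
  have hm : Measurable fun x : A × UnitAddCircle × UnitAddCircle =>
    (F (x.1, x.2.1), F (x.1, x.2.2)) := by fun_prop
  refine ⟨hm, eq_pairLaw (by linear_combination (p + q + 1) * hpq) fun s t hs ht => ?_⟩
  rw [Measure.map_apply hm (hs.prod ht), Measure.prod_apply (hm (hs.prod ht))]
  have h (a : A) : (circleMeasure.prod circleMeasure) (Prod.mk a ⁻¹'
      ((fun x : A × UnitAddCircle × UnitAddCircle => (F (x.1, x.2.1), F (x.1, x.2.2))) ⁻¹' s ×ˢ t)) =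
      p ^ 2 * (s ∩ t).indicator 1 a + (p * q * μ₀ t) * s.indicator 1 a +
        (p * q * μ₀ s) * t.indicator 1 a + q ^ 2 * (μ₀ s * μ₀ t) := by
    refine (Measure.prod_prod {u | F (a, u) ∈ s} {u | F (a, u) ∈ t}).trans ?_
    rw [hFκ a s hs, hFκ a t ht]
    have : (s ∩ t).indicator (1 : A → ℝ≥0∞) a = s.indicator 1 a * t.indicator 1 a := by
      by_cases h1 : a ∈ s <;> by_cases h2 : a ∈ t <;> simp [Set.indicator, h1, h2]
    rw [this]
    ring
  have hm0 : Measurable ((s ∩ t).indicator (1 : A → ℝ≥0∞)) := measurable_one.indicator (hs.inter ht)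
  have hm1 : Measurable (s.indicator (1 : A → ℝ≥0∞)) := measurable_one.indicator hs
  have hm2 : Measurable (t.indicator (1 : A → ℝ≥0∞)) := measurable_one.indicator ht
  simp only [h]
  rw [lintegral_add_right _ measurable_const, lintegral_add_right _ (hm2.const_mul _),
    lintegral_add_right _ (hm1.const_mul _), lintegral_const_mul _ hm0, lintegral_const_mul _ hm1,
    lintegral_const_mul _ hm2, lintegral_indicator_one (hs.inter ht), lintegral_indicator_one hs,
    lintegral_indicator_one ht, lintegral_const, measure_univ]
  push_cast
  ring

end Resampling

section Zip

variable {G : Type} {A B B' : Type} [MeasurableSpace A] [MeasurableSpace B] [MeasurableSpace B']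
  {α : Measure A} {β : Measure B} {β' : Measure B'} [IsProbabilityMeasure α]
  [IsProbabilityMeasure β] [IsProbabilityMeasure β']

theorem measurePreserving_zip :
    MeasurePreserving (fun (x : (G → A) × (G → B)) g => (x.1 g, x.2 g))
      ((bern G α).prod (bern G β)) (bern G (α.prod β)) := by
  have hm : Measurable fun (x : (G → A) × (G → B)) g => (x.1 g, x.2 g) := by fun_prop
  refine ⟨hm, ?_⟩
  have hu := measurePreserving_unzip (G := G) (α := α) (β := β)
  rw [← hu.map_eq, Measure.map_map hm hu.measurable]
  exact Measure.map_id

theorem measurePreserving_zip_zip :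
    MeasurePreserving (fun (x : (G → A) × (G → B) × (G → B')) g => (x.1 g, x.2.1 g, x.2.2 g))
      ((bern G α).prod ((bern G β).prod (bern G β'))) (bern G (α.prod (β.prod β'))) :=
  (measurePreserving_zip (α := α) (β := β.prod β')).comp
    ((MeasurePreserving.id (bern G α)).prod (measurePreserving_zip (α := β) (β := β')))

end Zip

section SpectralGap

open Filter Topology
open scoped NNReal

variable {G : Type} {A : Type}

/-- Coordinatewise resampling of a Bernoulli configuration. -/
def resample (F : A × UnitAddCircle → A) (x : G → A) (w : G → UnitAddCircle) : G → A :=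
  fun g => F (x g, w g)

theorem resample_smul [Group G] (F : A × UnitAddCircle → A) (g : G) (x : G → A)
    (w : G → UnitAddCircle) : resample F (g • x) (g • w) = g • resample F x w := rfl

variable [MeasurableSpace A] {μ₀ : Measure A} [IsProbabilityMeasure μ₀] {p q : ℝ≥0}
  {F : A × UnitAddCircle → A}

theorem measurable_resample (hF : Measurable F) :
    Measurable (Function.uncurry (resample F : (G → A) → (G → UnitAddCircle) → G → A)) := by
  unfold resample Function.uncurry
  fun_prop

theorem measurePreserving_resample_left (hpq : p + q = 1) (hF : Measurable F)
    (hFκ : ∀ a s, MeasurableSet s →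
      circleMeasure {u | F (a, u) ∈ s} = p * s.indicator 1 a + q * μ₀ s) :
    MeasurePreserving (fun (x : (G → A) × (G → UnitAddCircle)) g => (x.1 g, resample F x.1 x.2 g))
      ((bern G μ₀).prod (bern G circleMeasure)) (bern G (pairLaw μ₀ p q)) :=
  have := isProbabilityMeasure_pairLaw (μ₀ := μ₀) hpq
  (measurePreserving_bern_map (map_resample_left hpq hF hFκ)).comp measurePreserving_zip

theorem measurePreserving_resample_both (hpq : p + q = 1) (hF : Measurable F)
    (hFκ : ∀ a s, MeasurableSet s →
      circleMeasure {u | F (a, u) ∈ s} = p * s.indicator 1 a + q * μ₀ s) :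
    MeasurePreserving (fun (x : (G → A) × (G → UnitAddCircle) × (G → UnitAddCircle)) g =>
        (resample F x.1 x.2.1 g, resample F x.1 x.2.2 g))
      ((bern G μ₀).prod ((bern G circleMeasure).prod (bern G circleMeasure)))
      (bern G (pairLaw μ₀ (p ^ 2) (2 * p * q + q ^ 2))) :=
  have := isProbabilityMeasure_pairLaw (μ₀ := μ₀) (p := p ^ 2) (q := 2 * p * q + q ^ 2)
    (by linear_combination (p + q + 1) * hpq)
  (measurePreserving_bern_map (map_resample_both hpq hF hFκ)).comp measurePreserving_zip_zip

variable [Group G] [Countable G] {H : Type} [Group H] [Countable H] [MeasurableSpace H]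
  [DiscreteMeasurableSpace H] {c : G → (G → A) → H}

theorem totalMass_image_mul_le (hcm : ∀ g, Measurable (c g))
    (hcoc : ∀ g g', ∀ᵐ x ∂bern G μ₀, c (g * g') x = c g (g' • x) * c g' x)
    (hpq : p + q = 1) (hF : Measurable F)
    (hFκ : ∀ a s, MeasurableSet s →
      circleMeasure {u | F (a, u) ∈ s} = p * s.indicator 1 a + q * μ₀ s)
    (C : Subgroup G) (h : C) {k : G} (hk : Commute (h : G) k) (E : Set C) {δ : ℝ≥0} (hδ : δ ≠ 0) :
    totalMass (bern G μ₀) C (fun x w => c k (resample F x w)) ((h * ·) '' E) ≤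
      totalMass (bern G μ₀) C (fun x w => c k (resample F x w)) E +
        (δ + (1 + (δ⁻¹ : ℝ≥0)) * (2 * (2 * bern G (pairLaw μ₀ p q)
          {z | c h (fun g => (z g).1) ≠ c h (fun g => (z g).2)}))) := by
  have := isProbabilityMeasure_pairLaw (μ₀ := μ₀) hpq
  have hθ := measurable_resample (G := G) hF
  have hηm : Measurable (Function.uncurry fun (x : G → A) w => c k (resample F x w)) :=
    (hcm k).comp hθ
  have hmp := measurePreserving_resample_left (G := G) hpq hF hFκ
  have hsnd : MeasurePreserving (fun (z : G → A × A) g => (z g).2)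
      (bern G (pairLaw μ₀ p q)) (bern G μ₀) :=
    measurePreserving_bern_map (measurePreserving_snd_pairLaw hpq)
  have hbad : MeasurableSet {z : G → A × A | c h (fun g => (z g).1) ≠ c h (fun g => (z g).2)} :=
    (measurableSet_eq_fun_discrete ((hcm h).comp (by fun_prop)) ((hcm h).comp (by fun_prop))).compl
  rw [← totalMass_smul C hηm h E]
  have hm1 : Measurable (Function.uncurry fun (x : G → A) (w : G → UnitAddCircle) =>
      c k (resample F ((h : G) • x) ((h : G) • w))) :=
    hηm.comp (((measurable_bernoulli_smul (h : G)).comp measurable_fst).prodMk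
      ((measurable_bernoulli_smul (h : G)).comp measurable_snd))
  have hm2 : Measurable (Function.uncurry fun (x : G → A) (w : G → UnitAddCircle) =>
      c h (k • x) * c k (resample F x w) * (c h x)⁻¹) :=
    ((((hcm h).comp (measurable_bernoulli_smul k)).comp measurable_fst).mul hηm).mul
      ((hcm h).comp measurable_fst).inv
  refine (totalMass_le C hm1 hm2 E hδ).trans ?_
  rw [totalMass_mul_mul C (fun x w => c k (resample F x w)) (fun x => c h (k • x))
    (fun x => (c h x)⁻¹) E]
  gcongr
  have hae : ∀ᵐ x ∂(bern G μ₀).prod (bern G circleMeasure),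
      c k ((h : G) • resample F x.1 x.2) * c h (resample F x.1 x.2) =
        c h (k • resample F x.1 x.2) * c k (resample F x.1 x.2) := by
    filter_upwards [(hsnd.comp hmp).quasiMeasurePreserving.ae (hcoc k h),
      (hsnd.comp hmp).quasiMeasurePreserving.ae (hcoc h k)] with x h1 h2
    exact h1.symm.trans ((congrArg (fun g => c g (resample F x.1 x.2)) hk.eq.symm).trans h2)
  have hbad1 := hmp.measure_preimage hbad.nullMeasurableSet
  have hbad2 := ((measurePreserving_smul_bern k).comp hmp).measure_preimage hbad.nullMeasurableSet
  rw [two_mul]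
  conv_rhs => rw [← hbad1]
  conv_rhs => enter [2]; rw [hbad1, ← hbad2]
  refine le_trans (measure_mono_ae ?_) (measure_union_le _ _)
  filter_upwards [hae] with x hx hne
  by_contra hcon
  have h1 : c h x.1 = c h (resample F x.1 x.2) := by
    by_contra h1
    exact hcon (Or.inl h1)
  have h2 : c h (k • x.1) = c h (k • resample F x.1 x.2) := by
    by_contra h2
    exact hcon (Or.inr h2)
  refine hne ?_
  rw [resample_smul, h1, h2, ← hx, mul_inv_cancel_right]

/-- Uniform closeness of a cocycle on the powers of an element with nonamenable centralizer. -/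
theorem eventually_forall_pow_le [StandardBorelSpace A] (hcm : ∀ g, Measurable (c g))
    (hcoc : ∀ g g', ∀ᵐ x ∂bern G μ₀, c (g * g') x = c g (g' • x) * c g' x) {s₀ : G}
    (hcent : ¬ IsAmenable ↥(Subgroup.centralizer {s₀})) {p q : ℕ → ℝ≥0}
    (hpq : ∀ n, p n + q n = 1) (hq : Tendsto q atTop (𝓝 0)) {ε : ℝ≥0} (hε : 0 < ε) :
    ∀ᶠ n in atTop, ∀ j : ℕ, bern G (pairLaw μ₀ (p n ^ 2) (2 * p n * q n + q n ^ 2))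
      {z | c (s₀ ^ j) (fun g => (z g).1) ≠ c (s₀ ^ j) (fun g => (z g).2)} ≤ ε := by
  by_contra hcon
  rw [not_eventually] at hcon
  simp only [not_forall, not_le] at hcon
  obtain ⟨φ, hφ, hbad⟩ := extraction_of_frequently_atTop hcon
  choose j hj using hbad
  choose F hF hFκ using fun n => exists_resample μ₀ (hpq (φ n))
  let C := Subgroup.centralizer {s₀}
  let M (n : ℕ) (E : Set C) : ℝ≥0∞ :=
    totalMass (bern G μ₀) C (fun x w => c (s₀ ^ j n) (resample (F n) x w)) E
  have hηm (n : ℕ) : Measurable (Function.uncurry fun (x : G → A) w =>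
      c (s₀ ^ j n) (resample (F n) x w)) := (hcm _).comp (measurable_resample (hF n))
  have hadd (n : ℕ) (E E' : Set C) (h : Disjoint E E') : M n (E ∪ E') = M n E + M n E' :=
    totalMass_union C (hηm n) h
  have huniv1 (n : ℕ) : M n Set.univ ≤ 1 := (totalMass_univ C (hηm n)).trans_le prob_le_one
  have hunivε (n : ℕ) : (ε : ℝ≥0∞) < M n Set.univ := by
    refine (hj n).trans_eq ?_
    have := isProbabilityMeasure_pairLaw (μ₀ := μ₀) (p := p (φ n) ^ 2)
      (q := 2 * p (φ n) * q (φ n) + q (φ n) ^ 2)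
      (by linear_combination (p (φ n) + q (φ n) + 1) * hpq (φ n))
    refine Eq.trans ?_ (totalMass_univ C (hηm n)).symm
    refine ((measurePreserving_resample_both (hpq (φ n)) (hF n) (hFκ n)).measure_preimage ?_).symm
    exact ((measurableSet_eq_fun_discrete ((hcm _).comp (by fun_prop))
      ((hcm _).comp (by fun_prop))).compl).nullMeasurableSet
  have hle (n : ℕ) (E : Set C) : M n E ≤ M n Set.univ := by
    rw [← Set.union_compl_self E, hadd n E Eᶜ disjoint_compl_right]
    exact le_self_add
  have htop (n : ℕ) (E : Set C) : M n E ≠ ∞ :=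
    ne_top_of_le_ne_top ENNReal.one_ne_top ((hle n E).trans (huniv1 n))
  have hpos (n : ℕ) : (ε : ℝ) < (M n Set.univ).toReal :=
    (ENNReal.toReal_lt_toReal ENNReal.coe_ne_top (htop n _)).mpr (hunivε n)
  have hε' : (0 : ℝ) < ε := hε
  refine hcent (isAmenable_of_asymptotically_invariant
    (m := fun n E => (M n E).toReal / (M n Set.univ).toReal)
    (fun n E => by positivity) (fun n => div_self (hε'.trans (hpos n)).ne') ?_ ?_)
  · intro n E E' h
    rw [hadd n E E' h, ENNReal.toReal_add (htop n E) (htop n E'), add_div]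
  · intro h E κ hκ
    let δ : ℝ≥0 := ⟨κ * ε / 2, by positivity⟩
    have hδ : δ ≠ 0 := by
      rw [← NNReal.coe_ne_zero]
      exact (show (0 : ℝ) < κ * ε / 2 by positivity).ne'
    let r (n : ℕ) : ℝ≥0∞ := bern G (pairLaw μ₀ (p (φ n)) (q (φ n)))
      {z | c h (fun g => (z g).1) ≠ c h (fun g => (z g).2)}
    have hr : Tendsto r atTop (𝓝 0) :=
      tendsto_bern_pairLaw_ne (fun n => hpq (φ n)) (hq.comp hφ.tendsto_atTop) (hcm h)
    have hrtop (n : ℕ) : r n ≠ ∞ := by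
      have := isProbabilityMeasure_pairLaw (μ₀ := μ₀) (hpq (φ n))
      exact measure_ne_top _ _
    have hstep (n : ℕ) : (M n ((h * ·) '' E)).toReal ≤
        (M n E).toReal + (δ + (1 + (δ : ℝ)⁻¹) * (2 * (2 * (r n).toReal))) := by
      have hcomm : Commute (h : G) (s₀ ^ j n) :=
        Commute.pow_right ((Subgroup.mem_centralizer_singleton_iff.mp h.2)) _
      have := totalMass_image_mul_le hcm hcoc (hpq (φ n)) (hF n) (hFκ n) C h hcomm E hδ
      have h2 := ENNReal.toReal_mono (by
        have := htop n E
        have := hrtop n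
        finiteness) this
      rw [ENNReal.toReal_add (htop n E) (by have := hrtop n; finiteness),
        ENNReal.toReal_add (by finiteness) (by have := hrtop n; finiteness)] at h2
      simpa [ENNReal.toReal_add] using h2
    have hlim : Tendsto (fun n => (δ : ℝ) + (1 + (δ : ℝ)⁻¹) * (2 * (2 * (r n).toReal))) atTop
        (𝓝 (κ * ε / 2)) := by
      have h0 : Tendsto (fun n => (r n).toReal) atTop (𝓝 0) := by
        simpa [Function.comp_def] using (ENNReal.tendsto_toReal ENNReal.zero_ne_top).comp hr
      have := (((h0.const_mul 2).const_mul 2).const_mul (1 + (δ : ℝ)⁻¹)).const_add (δ : ℝ)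
      rw [show κ * ε / 2 = (δ : ℝ) from rfl]
      simpa using this
    filter_upwards [hlim.eventually_lt_const (show κ * ε / 2 < κ * ε by
      have : 0 < κ * ε := by positivity
      linarith)] with n hn
    have hp := hε'.trans (hpos n)
    rw [div_add' _ _ _ hp.ne', div_le_div_iff_of_pos_right hp]
    have : κ * ε ≤ κ * (M n Set.univ).toReal := by
      have := hpos n
      gcongr
    linarith [hstep n]

end SpectralGap

section Interpolation

open Filter Topology
open scoped NNReal

variable {A : Type} {N : ℕ}

/-- The `j`-th interpolation between the first two coordinates. -/
def interpolate (j : ℕ) (b : A × A × Fin N) : A :=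
  if (b.2.2 : ℕ) < j then b.2.1 else b.1

theorem interpolate_zero (b : A × A × Fin N) : interpolate 0 b = b.1 := by
  simp [interpolate]

theorem interpolate_top (b : A × A × Fin N) : interpolate N b = b.2.1 := by
  simp [interpolate]

variable [MeasurableSpace A]

theorem measurable_interpolate (j : ℕ) :
    Measurable (interpolate j : A × A × Fin N → A) := by
  refine Measurable.ite ?_ (by fun_prop) (by fun_prop)
  exact (MeasurableSet.of_discrete (s := {i : Fin N | (i : ℕ) < j})).preimage
    (measurable_snd.comp measurable_snd)

variable {μ₀ : Measure A} [IsProbabilityMeasure μ₀] {p q : ℝ≥0} {ν : Measure (Fin N)}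
  [IsProbabilityMeasure ν]

theorem measurePreserving_interpolate (hpq : p + q = 1) (hν : ∀ i, ν {i} = q) (j : Fin N) :
    MeasurePreserving (fun b : A × A × Fin N => (interpolate j b, interpolate (j + 1) b))
      (μ₀.prod (μ₀.prod ν)) (pairLaw μ₀ p q) := by
  have hm : Measurable fun b : A × A × Fin N => (interpolate (j : ℕ) b, interpolate (j + 1) b) :=
    (measurable_interpolate _).prodMk (measurable_interpolate _)
  refine ⟨hm, eq_pairLaw hpq fun s t hs ht => ?_⟩
  rw [Measure.map_apply hm (hs.prod ht)]
  have hset : (fun b : A × A × Fin N => (interpolate (j : ℕ) b, interpolate (j + 1) b)) ⁻¹' s ×ˢ t =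
      Set.univ ×ˢ (s ∩ t) ×ˢ Set.Iio j ∪
        ((s ∩ t) ×ˢ Set.univ ×ˢ Set.Ioi j ∪ s ×ˢ t ×ˢ {j}) := by
    ext ⟨x, y, i⟩
    rcases lt_trichotomy i j with h | h | h
    · simp [interpolate, h, h.le, h.ne, h.not_gt]
    · subst h
      simp [interpolate]
    · simp [interpolate, h, h.not_ge, h.ne', h.not_gt]
  have hu : (Set.univ : Set (Fin N)) = Set.Iio j ∪ (Set.Ioi j ∪ {j}) := by
    ext i
    rcases lt_trichotomy i j with h | h | h <;> simp [h]
  have hd1 : Disjoint (Set.Iio j) (Set.Ioi j ∪ {j}) := by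
    rw [Set.disjoint_left]
    intro i hi h
    simp only [Set.mem_Iio, Set.mem_union, Set.mem_Ioi, Set.mem_singleton_iff] at hi h
    rcases h with h | h
    · exact lt_asymm hi h
    · exact hi.ne h
  have hd2 : Disjoint (Set.Ioi j) {j} := by simp
  have hmass : ν (Set.Iio j) + ν (Set.Ioi j) = p := by
    have h1 := measure_univ (μ := ν)
    rw [hu, measure_union hd1 .of_discrete, measure_union hd2 .of_discrete, hν, ← add_assoc] at h1
    have h2 : (p : ℝ≥0∞) + q = 1 := by exact_mod_cast hpq
    exact (ENNReal.add_left_inj ENNReal.coe_ne_top).mp (h1.trans h2.symm)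
  have hst := hs.inter ht
  rw [hset, measure_union, measure_union]
  · simp only [Measure.prod_prod, measure_univ, one_mul, hν]
    rw [← hmass]
    ring
  · exact Set.disjoint_left.mpr fun b hb hb' => hd2.le_bot ⟨hb.2.2, hb'.2.2⟩
  · exact hs.prod (ht.prod .of_discrete)
  · refine Set.disjoint_left.mpr fun b hb hb' => hd1.le_bot ⟨hb.2.2, ?_⟩
    exact hb'.imp (fun h => h.2.2) (fun h => h.2.2)
  · exact (hst.prod (MeasurableSet.univ.prod .of_discrete)).union (hs.prod (ht.prod .of_discrete))

variable {G : Type} [Group G] {H : Type} [Group H] [Countable H] [MeasurableSpace H]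
  [DiscreteMeasurableSpace H]

/-- Transfer maps along nearby pairs compose to transfer maps along the interpolation. -/
theorem exists_transfer_interpolate (hpq : p + q = 1) (hν : ∀ i, ν {i} = q) {s : G}
    {f : (G → A) → H} {φ : (G → A × A) → H} (hφ : Measurable φ)
    (h : ∀ᵐ z ∂bern G (pairLaw μ₀ p q),
      f (fun g => (z g).1) * φ z = φ (s • z) * f (fun g => (z g).2)) (j : ℕ) (hj : j ≤ N) :
    ∃ Φ : (G → A × A × Fin N) → H, Measurable Φ ∧ ∀ᵐ z ∂bern G (μ₀.prod (μ₀.prod ν)),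
      f (fun g => (z g).1) * Φ z = Φ (s • z) * f (fun g => interpolate j (z g)) := by
  have := isProbabilityMeasure_pairLaw (μ₀ := μ₀) hpq
  induction j with
  | zero => exact ⟨fun _ => 1, measurable_const, by simp [interpolate_zero]⟩
  | succ j ih =>
    obtain ⟨Φ, hΦ, hΦf⟩ := ih (by omega)
    have hmp := measurePreserving_bern_map (G := G)
      (measurePreserving_interpolate (μ₀ := μ₀) hpq hν ⟨j, hj⟩)
    refine ⟨fun z => Φ z * φ (fun g => (interpolate j (z g), interpolate (j + 1) (z g))),
      hΦ.mul (hφ.comp hmp.measurable), ?_⟩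
    filter_upwards [hΦf, hmp.quasiMeasurePreserving.ae h] with z h1 h2
    rw [← mul_assoc, h1, mul_assoc, mul_assoc]
    exact congrArg _ h2

end Interpolation

section Straighten

open Filter Topology
open scoped NNReal

variable {G : Type} [Group G] {A : Type} [MeasurableSpace A] {μ₀ : Measure A}
  [IsProbabilityMeasure μ₀] {H : Type} [Group H] [Countable H] [MeasurableSpace H]
  [DiscreteMeasurableSpace H] {c : G → (G → A) → H}

theorem exists_straighten_of_transfer {s : G} (hs : ¬ IsOfFinOrder s) (N : ℕ) {p q : ℝ≥0}
    (hpq : p + q = 1) (hq : (N + 1) * q = 1) {f : (G → A) → H}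
    {φ : (G → A × A) → H} (hφ : Measurable φ)
    (h : ∀ᵐ z ∂bern G (pairLaw μ₀ p q),
      f (fun g => (z g).1) * φ z = φ (s • z) * f (fun g => (z g).2)) :
    ∃ a : (G → A) → H, Measurable a ∧ ∃ δ, ∀ᵐ x ∂bern G μ₀, (a (s • x))⁻¹ * f x * a x = δ := by
  let ν : Measure (Fin (N + 1)) := q • Measure.count
  have hνi (i : Fin (N + 1)) : ν {i} = q := by
    simp only [ν, Measure.smul_apply, Measure.count_singleton]
    simp
  have : IsProbabilityMeasure ν := by
    refine ⟨?_⟩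
    have : (q : ℝ≥0∞) * (N + 1) = 1 := by
      rw [mul_comm]
      exact_mod_cast hq
    rw [Measure.smul_apply, Measure.count_univ, ENNReal.smul_def, smul_eq_mul]
    simpa using this
  obtain ⟨Φ, hΦ, hΦf⟩ := exists_transfer_interpolate hpq hνi hφ h (N + 1) le_rfl
  have hz := measurePreserving_zip (G := G) (α := μ₀) (β := μ₀.prod ν)
  refine exists_untwist (β := μ₀.prod ν) (d := fun w => f fun g => (w g).1)
    (Φ := fun x => Φ fun g => (x.1 g, x.2 g)) hs (hΦ.comp hz.measurable) ?_
  filter_upwards [hz.quasiMeasurePreserving.ae hΦf] with x hx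
  simp only [interpolate_top] at hx
  exact hx

/-- A cocycle of a Bernoulli action is cohomologous to a constant on an element of infinite order
whose centralizer is nonamenable. -/
theorem exists_straighten [Countable G] [StandardBorelSpace A] (hcm : ∀ g, Measurable (c g))
    (hcoc : ∀ g g', ∀ᵐ x ∂bern G μ₀, c (g * g') x = c g (g' • x) * c g' x) {s₀ : G}
    (hs : ¬ IsOfFinOrder s₀) (hcent : ¬ IsAmenable ↥(Subgroup.centralizer {s₀})) :
    ∃ a : (G → A) → H, Measurable a ∧
      ∃ δ, ∀ᵐ x ∂bern G μ₀, (a (s₀ • x))⁻¹ * c s₀ x * a x = δ := by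
  let p (n : ℕ) : ℝ≥0 := NNReal.sqrt (1 - 1 / ((n : ℝ≥0) + 1))
  have hp1 (n : ℕ) : p n ≤ 1 := by
    rw [NNReal.sqrt_le_one]
    exact tsub_le_self
  let q (n : ℕ) : ℝ≥0 := 1 - p n
  have hpq (n : ℕ) : p n + q n = 1 := add_tsub_cancel_of_le (hp1 n)
  have hq : Tendsto q atTop (𝓝 0) := by
    have h1 : Tendsto (fun n : ℕ => 1 / ((n : ℝ≥0) + 1)) atTop (𝓝 0) :=
      tendsto_one_div_add_atTop_nhds_zero_nat
    have h2 := (NNReal.continuous_sqrt.tendsto _).comp (tendsto_const_nhds (x := (1 : ℝ≥0)).sub h1)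
    have h3 := tendsto_const_nhds (x := (1 : ℝ≥0)).sub h2
    simpa [q, p] using h3
  have hsq (n : ℕ) : ((n : ℝ≥0) + 1) * (2 * p n * q n + q n ^ 2) = 1 := by
    have h1 : p n ^ 2 = 1 - 1 / ((n : ℝ≥0) + 1) := NNReal.sq_sqrt _
    have h2 : (1 : ℝ≥0) / (n + 1) ≤ 1 := by
      rw [div_le_one (by positivity)]
      exact le_add_self
    have h3 : p n ^ 2 + 1 / ((n : ℝ≥0) + 1) = 1 := by rw [h1, tsub_add_cancel_of_le h2]
    have h4 : p n ^ 2 + (2 * p n * q n + q n ^ 2) = 1 := by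
      linear_combination (p n + q n + 1) * hpq n
    have h5 := add_left_cancel (h4.trans h3.symm)
    rw [h5]
    field_simp
  obtain ⟨n, hn⟩ := (eventually_forall_pow_le hcm hcoc hcent hpq hq
    (ε := 1 / 8) (by positivity)).exists
  have hpq2 : p n ^ 2 + (2 * p n * q n + q n ^ 2) = 1 := by
    linear_combination (p n + q n + 1) * hpq n
  have := isProbabilityMeasure_pairLaw (μ₀ := μ₀) hpq2
  have hfst : MeasurePreserving (fun (z : G → A × A) g => (z g).1)
      (bern G (pairLaw μ₀ (p n ^ 2) (2 * p n * q n + q n ^ 2))) (bern G μ₀) :=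
    measurePreserving_bern_map (measurePreserving_fst_pairLaw hpq2)
  have hsnd : MeasurePreserving (fun (z : G → A × A) g => (z g).2)
      (bern G (pairLaw μ₀ (p n ^ 2) (2 * p n * q n + q n ^ 2))) (bern G μ₀) :=
    measurePreserving_bern_map (measurePreserving_snd_pairLaw hpq2)
  have hmf (g : G) := (hcm g).comp hfst.measurable
  have hms (g : G) := (hcm g).comp hsnd.measurable
  have hone : ∀ᵐ x ∂bern G μ₀, c (s₀ ^ 0) x = 1 := by
    filter_upwards [hcoc 1 1] with x hx
    simpa using hx
  obtain ⟨φ, hφ, hφc⟩ := exists_transfer (measurePreserving_smul_bern s₀)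
    (fun E hE hinv hpos => ae_mem_of_smul_invariant hs hE hinv hpos)
    (u := fun z : G → A × A => c s₀ fun g => (z g).1)
    (v := fun z : G → A × A => c s₀ fun g => (z g).2)
    (un := fun j (z : G → A × A) => c (s₀ ^ j) fun g => (z g).1)
    (vn := fun j (z : G → A × A) => c (s₀ ^ j) fun g => (z g).2)
    (hmf s₀) (hms s₀) (fun j => hmf _) (fun j => hms _)
    (hfst.quasiMeasurePreserving.ae hone) (hsnd.quasiMeasurePreserving.ae hone)
    (fun j => by
      filter_upwards [hfst.quasiMeasurePreserving.ae (hcoc (s₀ ^ j) s₀)] with z hz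
      rw [pow_succ]
      exact hz)
    (fun j => by
      filter_upwards [hsnd.quasiMeasurePreserving.ae (hcoc (s₀ ^ j) s₀)] with z hz
      rw [pow_succ]
      exact hz)
    (ε := 1 / 8) (by norm_num)
    (fun j => by
      have hE := measurableSet_eq_fun_discrete (hmf (s₀ ^ j)) (hms (s₀ ^ j))
      have h1 := ENNReal.toReal_mono ENNReal.coe_ne_top (hn j)
      have h2 := probReal_compl_eq_one_sub
        (μ := bern G (pairLaw μ₀ (p n ^ 2) (2 * p n * q n + q n ^ 2))) hE
      have h3 : (bern G (pairLaw μ₀ (p n ^ 2) (2 * p n * q n + q n ^ 2))).real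
        {z | (c (s₀ ^ j) ∘ fun (z : G → A × A) g => (z g).1) z =
          (c (s₀ ^ j) ∘ fun (z : G → A × A) g => (z g).2) z}ᶜ ≤ 1 / 8 := by
        simpa [Measure.real, Set.compl_ofPred] using h1
      change 1 - 1 / 8 ≤ (bern G (pairLaw μ₀ (p n ^ 2) (2 * p n * q n + q n ^ 2))).real
        {z | (c (s₀ ^ j) ∘ fun (z : G → A × A) g => (z g).1) z =
          (c (s₀ ^ j) ∘ fun (z : G → A × A) g => (z g).2) z}
      linarith)
  exact exists_straighten_of_transfer hs n hpq2 (hsq n) hφ hφc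

end Straighten

section Propagation

variable {G : Type} [Group G] {A : Type} [MeasurableSpace A] {μ₀ : Measure A}
  [IsProbabilityMeasure μ₀] {H : Type} [Group H]

theorem exists_monoidHom_of_ae_eq_const [Countable G] {c : G → (G → A) → H}
    (hcoc : ∀ g g', ∀ᵐ x ∂bern G μ₀, c (g * g') x = c g (g' • x) * c g' x)
    (hconst : ∀ g, ∃ a, ∀ᵐ x ∂bern G μ₀, c g x = a) :
    ∃ δ : G →* H, ∀ g, ∀ᵐ x ∂bern G μ₀, c g x = δ g := by
  choose δ hδ using hconst
  refine ⟨MonoidHom.mk' δ fun g g' => ?_, hδ⟩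
  obtain ⟨x, h1, h2, h3, h4⟩ := ((hδ (g * g')).and ((hδ g').and ((hcoc g g').and
    ((measurePreserving_smul_bern g').quasiMeasurePreserving.ae (hδ g))))).exists
  rw [← h1, h3, h2, h4]

variable {c : G → (G → A) → H}

/-- The elements on which a cocycle is almost everywhere constant form a subgroup. -/
def constSubgroup [Countable G]
    (hcoc : ∀ g g', ∀ᵐ x ∂bern G μ₀, c (g * g') x = c g (g' • x) * c g' x) : Subgroup G where
  carrier := {g | ∃ a, ∀ᵐ x ∂bern G μ₀, c g x = a}
  one_mem' := by
    refine ⟨1, ?_⟩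
    filter_upwards [hcoc 1 1] with x hx
    simpa using hx
  mul_mem' := by
    rintro g g' ⟨a, ha⟩ ⟨b, hb⟩
    refine ⟨a * b, ?_⟩
    filter_upwards [hcoc g g', hb,
      (measurePreserving_smul_bern g').quasiMeasurePreserving.ae ha] with x h1 h2 h3
    rw [h1, h2, h3]
  inv_mem' := by
    rintro g ⟨a, ha⟩
    refine ⟨a⁻¹, ?_⟩
    filter_upwards [hcoc g g⁻¹, hcoc 1 1,
      (measurePreserving_smul_bern g⁻¹).quasiMeasurePreserving.ae ha] with x h1 h2 h3
    rw [h3, mul_inv_cancel] at h1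
    have h4 : c 1 x = 1 := by simpa using h2
    rw [eq_inv_iff_mul_eq_one, mul_eq_one_iff_eq_inv, eq_comm, inv_eq_iff_mul_eq_one, ← h1, h4]

variable [Countable H] [MeasurableSpace H] [DiscreteMeasurableSpace H]

theorem exists_ae_eq_const_of_commute (hcm : ∀ g, Measurable (c g))
    (hcoc : ∀ g g', ∀ᵐ x ∂bern G μ₀, c (g * g') x = c g (g' • x) * c g' x) {s t : G}
    (hst : Commute s t) (hs : ¬ IsOfFinOrder s) (h : ∃ a, ∀ᵐ x ∂bern G μ₀, c s x = a) :
    ∃ a, ∀ᵐ x ∂bern G μ₀, c t x = a := by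
  obtain ⟨δ, hδ⟩ := h
  refine exists_ae_eq_const_of_conj hs (hcm t) (δ := δ) ?_
  filter_upwards [hδ, (measurePreserving_smul_bern t).quasiMeasurePreserving.ae hδ,
    hcoc s t, hcoc t s] with x h1 h2 h3 h4
  rw [← h1, ← h4, h1, ← h2, ← h3, hst.eq]

theorem exists_ae_eq_const_of_mem (hcm : ∀ g, Measurable (c g))
    (hcoc : ∀ g g', ∀ᵐ x ∂bern G μ₀, c (g * g') x = c g (g' • x) * c g' x) {S : Set G}
    (hSchain : IsChainCommuting S) (hSord : ∀ s ∈ S, ¬ IsOfFinOrder s) {s₀ : G} (hs₀ : s₀ ∈ S)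
    (h : ∃ a, ∀ᵐ x ∂bern G μ₀, c s₀ x = a) {s : G} (hs : s ∈ S) :
    ∃ a, ∀ᵐ x ∂bern G μ₀, c s x = a := by
  obtain ⟨w⟩ := hSchain.preconnected ⟨s, hs⟩ ⟨s₀, hs₀⟩
  suffices ∀ {u v : S} (_ : (chainCommGraph S).Walk u v), (v : G) = s₀ →
      ∃ a, ∀ᵐ x ∂bern G μ₀, c u x = a from this w rfl
  intro u v w hv
  induction w with
  | nil => rwa [hv]
  | @cons u v _ huv _ ih =>
    have hcomm : Commute (v : G) u := by
      rcases (SimpleGraph.fromRel_adj _ _ _).mp huv with ⟨_, h | h⟩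
      · exact h.symm
      · exact h
    exact exists_ae_eq_const_of_commute hcm hcoc hcomm (hSord v v.2) (ih hv)

end Propagation

/-- Cocycle superrigidity of Bernoulli actions of groups with a finite
chain-commuting generating set of infinite-order elements, one of which has nonamenable
centralizer. -/
theorem stmt6
    (G : Type) [Group G] [Countable G]
    (S : Set G) (hSfin : S.Finite) (hSgen : Subgroup.closure S = ⊤)
    (hSchain : IsChainCommuting S)
    (hSord : ∀ s ∈ S, ¬ IsOfFinOrder s)
    (s₀ : G) (hs₀ : s₀ ∈ S)
    (hcent : ¬ IsAmenable ↥(Subgroup.centralizer {s₀}))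
    (A : Type) [MeasurableSpace A] [StandardBorelSpace A]
    (μ₀ : Measure A) [IsProbabilityMeasure μ₀]
    (hnontriv : ∀ a : A, μ₀ {a} ≠ 1)
    (μ : Measure (G → A)) [IsProbabilityMeasure μ] (hber : IsBernoulliMeasure G μ₀ μ)
    (H : Type) [Group H] [Countable H]
    (c : G → (G → A) → H) (hc : IsCocycle G (G → A) H μ c) :
    ∃ δ : G →* H, Cohomologous G (G → A) H μ c fun g _ => δ g := by
  obtain rfl := hber.eq_bern
  let _ : MeasurableSpace H := ⊤
  have : DiscreteMeasurableSpace H := ⟨fun _ => trivial⟩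
  obtain ⟨hcf, hcoc⟩ := hc
  have hcm (g : G) : Measurable (c g) := measurable_to_countable' (hcf g)
  obtain ⟨a, ha, d, hd⟩ := exists_straighten hcm hcoc (hSord s₀ hs₀) hcent
  let c' (g : G) (x : G → A) : H := (a (g • x))⁻¹ * c g x * a x
  have hcm' (g : G) : Measurable (c' g) :=
    ((ha.comp (measurable_bernoulli_smul g)).inv.mul (hcm g)).mul ha
  have hcoc' (g g' : G) : ∀ᵐ x ∂bern G μ₀, c' (g * g') x = c' g (g' • x) * c' g' x := by
    filter_upwards [hcoc g g'] with x hx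
    simp only [c', hx, mul_smul]
    group
  have hS : S ⊆ constSubgroup hcoc' := fun s hs =>
    exists_ae_eq_const_of_mem hcm' hcoc' hSchain hSord hs₀ ⟨d, hd⟩ hs
  have hall (g : G) : ∃ b, ∀ᵐ x ∂bern G μ₀, c' g x = b := by
    have : g ∈ Subgroup.closure S := hSgen ▸ Subgroup.mem_top g
    exact (Subgroup.closure_le _).mpr hS this
  obtain ⟨δ, hδ⟩ := exists_monoidHom_of_ae_eq_const hcoc' hall
  refine ⟨δ, fun x => (a x)⁻¹, fun h => ha.inv (MeasurableSet.of_discrete (s := {h})), fun g => ?_⟩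
  filter_upwards [hδ g] with x hx
  rw [inv_inv]
  exact hx.symm

end OEPaper
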